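/- arXiv:2205.13981 — 2 statements merged into one kernel-verified Lean document; each statement's English description precedes it below -/
import Mathlib

section
/- Let α, β, γ, δ : ℕ and let 𝒞 be an additive subgroup of (Fin α → ZMod 3) × (Fin β → ZMod 9) with 𝒞 ≃+ (Fin γ → ZMod 3) × (Fin δ → ZMod 9) as additive groups. Let C = Φ '' 𝒞, let rank(C) = Module.finrank (ZMod 3) (Submodule.span (ZMod 3) C), and suppose Nat.card (K(C)) = 3^(γ + 2δ − k̄) with 0 ≤ k̄ ≤ δ. If k̄ = 0 then rank(C) = γ + 2δ; and if k̄ ≥ 1, then γ + 2δ + 1 ≤ rank(C) ≤ γ + 2δ + choose(k̄, 2) + choose(k̄+2, 3). -/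
/-- The Gray map `φ : ZMod 9 → (Fin 3 → ZMod 3)`. -/
def gray3 (θ : ZMod 9) : Fin 3 → ZMod 3 :=
  fun i => ((θ.val / 3 : ℕ) : ZMod 3) + ((θ.val % 3 : ℕ) : ZMod 3) * ((i : ℕ) : ZMod 3)

/-- The extended Gray map `Φ`. -/
def Gray3 (α β : ℕ) (u : (Fin α → ZMod 3) × (Fin β → ZMod 9)) :
    (Fin α → ZMod 3) × (Fin β → Fin 3 → ZMod 3) :=
  (u.1, fun j => gray3 (u.2 j))

/-- The kernel `K(C) = {x : x + C = C}` of a subset `C`. -/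
def kernelSet {V : Type*} [AddCommGroup V] (C : Set V) : Set V :=
  {x | (fun c => x + c) '' C = C}

namespace GrayAux

abbrev U (α β : ℕ) := (Fin α → ZMod 3) × (Fin β → ZMod 9)
abbrev V (α β : ℕ) := (Fin α → ZMod 3) × (Fin β → Fin 3 → ZMod 3)

/-- Reduction mod 3 of the `ZMod 9` part. -/
def red (α β : ℕ) : U α β →+ (Fin β → ZMod 3) where
  toFun u := fun j => ZMod.castHom (by norm_num : 3 ∣ 9) (ZMod 3) (u.2 j)
  map_zero' := by ext j; simp
  map_add' u v := by
    ext j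
    exact map_add (ZMod.castHom (by norm_num : 3 ∣ 9) (ZMod 3)) (u.2 j) (v.2 j)

/-- The repetition map `w ↦ Φ(0, 3w)`. -/
def T (α β : ℕ) : (Fin β → ZMod 3) →ₗ[ZMod 3] V α β where
  toFun w := (0, fun j _ => w j)
  map_add' u v := by ext <;> simp
  map_smul' c u := by ext <;> simp

/-- The carry polynomial. -/
def P {β : ℕ} (a b : Fin β → ZMod 3) : Fin β → ZMod 3 := - (a * b * (a + b + 1))

lemma gray3_add (x y : ZMod 9) (i : Fin 3) :
    gray3 (x + y) i = gray3 x i + gray3 y i +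
      -((ZMod.castHom (by norm_num : 3 ∣ 9) (ZMod 3) x) *
        (ZMod.castHom (by norm_num : 3 ∣ 9) (ZMod 3) y) *
        ((ZMod.castHom (by norm_num : 3 ∣ 9) (ZMod 3) x) +
        (ZMod.castHom (by norm_num : 3 ∣ 9) (ZMod 3) y) + 1)) := by
  revert x y i; decide

lemma gray3_inj : ∀ x y : ZMod 9, (∀ i, gray3 x i = gray3 y i) → x = y := by decide

lemma gray3_three : ∀ (x : ZMod 9) (i : Fin 3), gray3 (x + x + x) i =
    ZMod.castHom (by norm_num : 3 ∣ 9) (ZMod 3) x := by decide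

lemma cast_surj : ∀ z : ZMod 3, ∃ x : ZMod 9,
    ZMod.castHom (by norm_num : 3 ∣ 9) (ZMod 3) x = z := by decide

variable {α β : ℕ}

lemma Gray_add (u v : U α β) :
    Gray3 α β (u + v) = Gray3 α β u + Gray3 α β v + T α β (P (red α β u) (red α β v)) := by
  refine Prod.ext ?_ ?_
  · simp [Gray3, T]
  · funext j i
    exact gray3_add (u.2 j) (v.2 j) i

lemma Gray_inj : Function.Injective (Gray3 α β) := by
  intro u v h
  refine Prod.ext (congrArg (fun z => z.1) h) ?_
  funext j
  apply gray3_inj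
  intro i
  exact congrFun (congrFun (congrArg (fun z => z.2) h) j) i

lemma Gray_three (u : U α β) : Gray3 α β (u + u + u) = T α β (red α β u) := by
  refine Prod.ext ?_ ?_
  · funext j
    have : ∀ x : ZMod 3, x + x + x = 0 := by decide
    exact this _
  · funext j i
    exact gray3_three _ i

lemma Gray_zero : Gray3 α β 0 = 0 := by
  refine Prod.ext rfl ?_
  funext j i
  have : ∀ i, gray3 0 i = 0 := by decide
  exact this i

lemma three_zero {n : ℕ} (w : Fin n → ZMod 3) : w + w + w = 0 := by
  have : ∀ x : ZMod 3, x + x + x = 0 := by decide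
  funext j; exact this _

lemma red_three (u : U α β) : red α β (u + u + u) = 0 := by
  rw [map_add, map_add]; exact three_zero _

lemma exists_T (w : Fin β → ZMod 3) : ∃ t : U α β, red α β t = 0 ∧ Gray3 α β t = T α β w := by
  choose f hf using cast_surj
  refine ⟨(fun t => t + t + t) ((0, fun j => f (w j)) : U α β), red_three _, ?_⟩
  rw [Gray_three]
  congr 1
  funext j
  exact hf _

lemma P_zero_left (b : Fin β → ZMod 3) : P 0 b = 0 := by simp [P]
lemma P_zero_right (b : Fin β → ZMod 3) : P b 0 = 0 := by simp [P]

lemma card_C {γ δ : ℕ} (𝒞 : AddSubgroup (U α β))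
    (e : 𝒞 ≃+ (Fin γ → ZMod 3) × (Fin δ → ZMod 9)) : Nat.card 𝒞 = 3 ^ (γ + 2 * δ) := by
  rw [Nat.card_congr e.toEquiv]
  simp [Nat.card_prod, Nat.card_eq_fintype_card]
  rw [pow_add, pow_mul]; norm_num

/-- The kernel as a submodule. -/
def Ksub {W : Type*} [AddCommGroup W] [Module (ZMod 3) W] (C : Set W) : Submodule (ZMod 3) W :=
  AddSubgroup.toZModSubmodule 3
  { carrier := kernelSet C
    zero_mem' := by simp [kernelSet]
    add_mem' := by
      intro a b ha hb
      simp only [kernelSet, Set.mem_ofPred_eq] at *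
      have : (fun c => a + b + c) = (fun c => a + c) ∘ (fun c => b + c) := by
        funext c; simp [add_assoc]
      rw [this, Set.image_comp, hb, ha]
    neg_mem' := by
      intro a ha
      simp only [kernelSet, Set.mem_ofPred_eq] at *
      conv_lhs => rw [← ha]
      rw [← Set.image_comp]
      simp [Function.comp_def] }

lemma mem_Ksub {W : Type*} [AddCommGroup W] [Module (ZMod 3) W] (C : Set W) (x : W) :
    x ∈ Ksub C ↔ x ∈ kernelSet C := Iff.rfl

lemma Ksub_sub {W : Type*} [AddCommGroup W] [Module (ZMod 3) W] {C : Set W} (h0 : (0 : W) ∈ C)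
    {x : W} (hx : x ∈ Ksub C) : x ∈ C := by
  have h : (fun c => x + c) '' C = C := hx
  rw [← h]
  exact ⟨0, h0, add_zero x⟩

lemma Ksub_add {W : Type*} [AddCommGroup W] [Module (ZMod 3) W] {C : Set W}
    {x y : W} (hx : x ∈ Ksub C) (hy : y ∈ C) : x + y ∈ C := by
  have h : (fun c => x + c) '' C = C := hx
  rw [← h]
  exact ⟨y, hy, rfl⟩

section
variable (𝒞 : AddSubgroup (U α β))

lemma zero_mem_C : (0 : V α β) ∈ Gray3 α β '' (𝒞 : Set (U α β)) := ⟨0, 𝒞.zero_mem, Gray_zero⟩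

lemma mem_C {u : U α β} : Gray3 α β u ∈ Gray3 α β '' (𝒞 : Set (U α β)) ↔ u ∈ 𝒞 := by
  rw [Gray_inj.mem_set_image]; rfl

lemma ker_of_red_zero {u : U α β} (hu : u ∈ 𝒞) (hr : red α β u = 0) :
    Gray3 α β u ∈ Ksub (Gray3 α β '' (𝒞 : Set (U α β))) := by
  rw [mem_Ksub]
  have key : ∀ v, Gray3 α β u + Gray3 α β v = Gray3 α β (u + v) := by
    intro v; rw [Gray_add, hr, P_zero_left, map_zero, add_zero]
  show (fun c => Gray3 α β u + c) '' _ = _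
  ext z
  constructor
  · rintro ⟨_, ⟨v, hv, rfl⟩, rfl⟩
    exact ⟨u + v, 𝒞.add_mem hu hv, (key v).symm⟩
  · rintro ⟨v, hv, rfl⟩
    refine ⟨_, ⟨v - u, 𝒞.sub_mem hv hu, rfl⟩, ?_⟩
    show Gray3 α β u + _ = _
    rw [key]; congr 1; abel

/-- coordinates `w` with `T w` in the kernel -/
def WK : Submodule (ZMod 3) (Fin β → ZMod 3) :=
  (Ksub (Gray3 α β '' (𝒞 : Set (U α β)))).comap (T α β)

lemma P_mem {u v : U α β} (hu : Gray3 α β u ∈ Ksub (Gray3 α β '' (𝒞 : Set (U α β))))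
    (hv : v ∈ 𝒞) : P (red α β u) (red α β v) ∈ WK 𝒞 := by
  have huC : u ∈ 𝒞 := (mem_C 𝒞).1 (Ksub_sub (zero_mem_C 𝒞) hu)
  obtain ⟨t, ht, htT⟩ := exists_T (α := α) (-(P (red α β u) (red α β v)))
  have h1 : Gray3 α β (u + v + t) = Gray3 α β u + Gray3 α β v := by
    rw [Gray_add, ht, P_zero_right, Gray_add, htT]; simp
  have h2 : u + v + t ∈ 𝒞 := by
    rw [← mem_C, h1]
    exact Ksub_add hu ⟨v, hv, rfl⟩
  have h3 : t ∈ 𝒞 := by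
    have := 𝒞.sub_mem h2 (𝒞.add_mem huC hv)
    simpa using this
  have h4 := ker_of_red_zero 𝒞 h3 ht
  rw [htT] at h4
  have h5 : -(P (red α β u) (red α β v)) ∈ WK 𝒞 := h4
  simpa using (WK 𝒞).neg_mem h5

lemma Gray_neg (u : U α β) : Gray3 α β (-u) =
    -(Gray3 α β u + T α β (P (red α β u) (red α β (-u)))) := by
  have := Gray_add u (-u)
  rw [add_neg_cancel, Gray_zero] at this
  rw [eq_neg_iff_add_eq_zero, this]; abel

/-- preimage of the kernel -/
def Kpre : AddSubgroup (U α β) where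
  carrier := {u | Gray3 α β u ∈ Ksub (Gray3 α β '' (𝒞 : Set (U α β)))}
  zero_mem' := by simp [Gray_zero]
  add_mem' := by
    intro u v hu hv
    have hvC : v ∈ 𝒞 := (mem_C 𝒞).1 (Ksub_sub (zero_mem_C 𝒞) hv)
    simp only [Set.mem_ofPred_eq] at *
    rw [Gray_add]
    exact add_mem (add_mem hu hv) (P_mem 𝒞 hu hvC)
  neg_mem' := by
    intro u hu
    have huC : u ∈ 𝒞 := (mem_C 𝒞).1 (Ksub_sub (zero_mem_C 𝒞) hu)
    simp only [Set.mem_ofPred_eq] at *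
    rw [Gray_neg]
    exact neg_mem (add_mem hu (P_mem 𝒞 hu (neg_mem huC)))

lemma Kpre_le : Kpre 𝒞 ≤ 𝒞 := fun _ hu => (mem_C 𝒞).1 (Ksub_sub (zero_mem_C 𝒞) hu)

lemma prods_mem {u v : U α β} (hu : u ∈ Kpre 𝒞) (hv : v ∈ 𝒞) :
    red α β u * red α β v ∈ WK 𝒞 ∧ red α β u * (red α β v * red α β v) ∈ WK 𝒞 := by
  have h1 := P_mem 𝒞 hu hv
  have h2 := P_mem 𝒞 ((Kpre 𝒞).neg_mem hu) hv
  have h3 := P_mem 𝒞 hu (neg_mem hv)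
  have h4 := P_mem 𝒞 ((Kpre 𝒞).neg_mem hu) (neg_mem hv)
  rw [map_neg] at h2 h3 h4
  rw [map_neg] at h4
  constructor
  · have h := add_mem h1 h4
    convert h using 1
    funext j
    have key : ∀ x y : ZMod 3, x * y = -(x * y * (x + y + 1)) + -(-x * -y * (-x + -y + 1)) := by decide
    exact key _ _
  · have h := add_mem h1 h3
    convert h using 1
    funext j
    have key : ∀ x y : ZMod 3, x * (y * y) = -(x * y * (x + y + 1)) + -(x * -y * (x + -y + 1)) := by decide
    exact key _ _

lemma triple_mem {u v w : U α β} (hu : u ∈ Kpre 𝒞) (hv : v ∈ 𝒞) (hw : w ∈ 𝒞) :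
    red α β u * red α β v * red α β w ∈ WK 𝒞 := by
  have h1 := (prods_mem 𝒞 hu hv).2
  have h2 := (prods_mem 𝒞 hu hw).2
  have h3 := (prods_mem 𝒞 hu (add_mem hv hw)).2
  have h := sub_mem (add_mem h1 h2) h3
  rw [map_add] at h
  convert h using 1
  funext j
  have key : ∀ x y z : ZMod 3, x * y * z = x * (y * y) + x * (z * z) - x * ((y + z) * (y + z)) := by decide
  exact key _ _ _

lemma exists_gens {n k : ℕ} (hk : k ≤ n) (h1 : Nat.card 𝒞 = 3 ^ n)
    (h2 : Nat.card (Kpre 𝒞) = 3 ^ (n - k)) :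
    ∃ y : Fin k → U α β, (∀ i, y i ∈ 𝒞) ∧ 𝒞 ≤ Kpre 𝒞 ⊔ AddSubgroup.closure (Set.range y) := by
  let Q := 𝒞 ⧸ (Kpre 𝒞).addSubgroupOf 𝒞
  have h3 : ∀ q : Q, 3 • q = 0 := by
    intro q
    obtain ⟨v, rfl⟩ := QuotientAddGroup.mk_surjective q
    rw [← QuotientAddGroup.mk_nsmul, QuotientAddGroup.eq_zero_iff, AddSubgroup.mem_addSubgroupOf]
    have e : ((3 • v : 𝒞) : U α β) = v + v + v := by
      simp [succ_nsmul]
    rw [e]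
    exact ker_of_red_zero 𝒞 (add_mem (add_mem v.2 v.2) v.2) (red_three _)
  letI : Module (ZMod 3) Q := AddCommGroup.zmodModule h3
  have hc : Nat.card Q = 3 ^ k := by
    have := AddSubgroup.card_eq_card_quotient_mul_card_addSubgroup ((Kpre 𝒞).addSubgroupOf 𝒞)
    rw [h1, Nat.card_congr (AddSubgroup.addSubgroupOfEquivOfLe (Kpre_le 𝒞)).toEquiv, h2] at this
    have h4 : 3 ^ n = 3 ^ k * 3 ^ (n - k) := by rw [← pow_add]; congr 1; omega
    rw [h4] at this
    exact (Nat.eq_of_mul_eq_mul_right (by positivity) this).symm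
  have hf : Module.finrank (ZMod 3) Q = k := by
    have := Module.natCard_eq_pow_finrank (K := ZMod 3) (V := Q)
    rw [hc, Nat.card_zmod] at this
    exact (Nat.pow_right_injective (by norm_num : 2 ≤ 3) this).symm
  let b := Module.finBasisOfFinrankEq (ZMod 3) Q hf
  choose f hf using fun i => QuotientAddGroup.mk_surjective (b i)
  refine ⟨fun i => f i, fun i => (f i).2, ?_⟩
  intro v hv
  have hs := b.sum_repr (QuotientAddGroup.mk ⟨v, hv⟩ : Q)
  set c := b.repr (QuotientAddGroup.mk ⟨v, hv⟩ : Q)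
  have hs2 : (QuotientAddGroup.mk (∑ i, (c i).val • f i) : Q) = QuotientAddGroup.mk ⟨v, hv⟩ := by
    rw [← hs, ← QuotientAddGroup.mk'_apply, map_sum]
    refine Finset.sum_congr rfl fun i _ => ?_
    rw [map_nsmul, QuotientAddGroup.mk'_apply, hf, ← Nat.cast_smul_eq_nsmul (ZMod 3)]
    simp
  rw [QuotientAddGroup.eq, AddSubgroup.mem_addSubgroupOf] at hs2
  have : v = ((-(∑ i, (c i).val • f i) + ⟨v, hv⟩ : 𝒞) : U α β) +
      ∑ i, (c i).val • (f i : U α β) := by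
    simp
  rw [this]
  refine AddSubgroup.add_mem_sup hs2 (sum_mem fun i _ => nsmul_mem (AddSubgroup.subset_closure (Set.mem_range_self i)) _)

/-- cubic generators, with the cubes replaced by squares -/
noncomputable def cub {k : ℕ} (a : Fin k → Fin β → ZMod 3) (s : Sym (Fin k) 3) : Fin β → ZMod 3 :=
  open Classical in
  if h : ∃ i, s = Sym.replicate 3 i then a h.choose * a h.choose
  else ((s : Multiset (Fin k)).map a).prod

lemma cub_sq {k : ℕ} (a : Fin k → Fin β → ZMod 3) (i : Fin k) :
    cub a (Sym.replicate 3 i) = a i * a i := by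
  have h : ∃ i', (Sym.replicate 3 i) = Sym.replicate 3 i' := ⟨i, rfl⟩
  have : h.choose = i := by
    have h2 := h.choose_spec
    have h3 : i ∈ Sym.replicate 3 h.choose := by rw [← h2]; simp [Sym.mem_replicate]
    rw [Sym.mem_replicate] at h3
    exact h3.2.symm
  rw [cub, dif_pos h, this]

lemma cub_prod {k : ℕ} (a : Fin k → Fin β → ZMod 3) (i j l : Fin k) :
    cub a (i ::ₛ j ::ₛ l ::ₛ Sym.nil) = a i * a j * a l ∨ a i * a j * a l = a i := by
  by_cases h : ∃ m, (i ::ₛ j ::ₛ l ::ₛ Sym.nil) = Sym.replicate 3 m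
  · right
    obtain ⟨m, hm⟩ := h
    have hi : i ∈ Sym.replicate 3 m := by rw [← hm]; simp
    have hj : j ∈ Sym.replicate 3 m := by rw [← hm]; simp
    have hl : l ∈ Sym.replicate 3 m := by rw [← hm]; simp
    rw [Sym.mem_replicate] at hi hj hl
    rw [hi.2, hj.2, hl.2]
    funext t
    have : ∀ x : ZMod 3, x * x * x = x := by decide
    exact this _
  · left
    rw [cub, dif_neg h]
    have hs : ((i ::ₛ j ::ₛ l ::ₛ Sym.nil : Sym (Fin k) 3) : Multiset (Fin k)) = {i, j, l} := rfl
    rw [hs]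
    simp [mul_assoc]

/-- quadratic generators -/
def quad {k : ℕ} (a : Fin k → Fin β → ZMod 3) (p : {p : Sym2 (Fin k) // ¬ p.IsDiag}) :
    Fin β → ZMod 3 :=
  Sym2.lift ⟨fun i j => a i * a j, fun i j => mul_comm _ _⟩ p.1

/-- The bounding subspace -/
noncomputable def M {k : ℕ} (y : Fin k → U α β) : Submodule (ZMod 3) (V α β) :=
  Ksub (Gray3 α β '' (𝒞 : Set (U α β))) ⊔ Submodule.span (ZMod 3) (Set.range fun i => Gray3 α β (y i))
   ⊔ Submodule.span (ZMod 3) (Set.range fun p => T α β (quad (fun i => red α β (y i)) p))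
   ⊔ Submodule.span (ZMod 3) (Set.range fun p => T α β (cub (fun i => red α β (y i)) p))

lemma finrank_M {k : ℕ} (y : Fin k → U α β) : Module.finrank (ZMod 3) (M 𝒞 y) ≤
    Module.finrank (ZMod 3) (Ksub (Gray3 α β '' (𝒞 : Set (U α β)))) + k + k.choose 2
      + (k + 2).choose 3 := by
  unfold M
  refine (Submodule.finrank_add_le_finrank_add_finrank _ _).trans (add_le_add ?_ ?_)
  refine (Submodule.finrank_add_le_finrank_add_finrank _ _).trans (add_le_add ?_ ?_)
  refine (Submodule.finrank_add_le_finrank_add_finrank _ _).trans (add_le_add le_rfl ?_)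
  · exact (finrank_range_le_card _).trans (by simp)
  · refine (finrank_range_le_card _).trans ?_
    rw [Sym2.card_subtype_not_diag]; simp
  · refine (finrank_range_le_card _).trans ?_
    rw [Sym.card_sym_eq_choose]; simp

lemma prod_le {k : ℕ} (y : Fin k → U α β) (hy : ∀ i, y i ∈ 𝒞)
    (hC : 𝒞 ≤ Kpre 𝒞 ⊔ AddSubgroup.closure (Set.range y)) :
    ∀ u ∈ 𝒞, ∀ v ∈ 𝒞, P (red α β u) (red α β v) ∈ (M 𝒞 y).comap (T α β) := by
  set W := (M 𝒞 y).comap (T α β) with hW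
  have hKW : WK 𝒞 ≤ W := by
    refine Submodule.comap_mono ?_
    unfold M
    exact le_sup_left.trans (le_sup_left.trans le_sup_left)
  set a := fun i => red α β (y i) with ha
  have hquad : ∀ p, quad a p ∈ W := by
    intro p
    show T α β _ ∈ M 𝒞 y
    exact Submodule.mem_sup_left (Submodule.mem_sup_right (Submodule.subset_span ⟨p, rfl⟩))
  have hcub : ∀ p, cub a p ∈ W := by
    intro p
    show T α β _ ∈ M 𝒞 y
    exact Submodule.mem_sup_right (Submodule.subset_span ⟨p, rfl⟩)
  have hred : ∀ u ∈ 𝒞, red α β u ∈ WK 𝒞 := by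
    intro u hu
    show T α β _ ∈ Ksub _
    rw [← Gray_three]
    exact ker_of_red_zero 𝒞 (add_mem (add_mem hu hu) hu) (red_three _)
  let G : Set (Fin β → ZMod 3) := red α β '' (Kpre 𝒞 : Set (U α β)) ∪ Set.range a
  have hG : ∀ g ∈ G, ∃ u ∈ 𝒞, red α β u = g := by
    rintro g (⟨u, hu, rfl⟩ | ⟨i, rfl⟩)
    · exact ⟨u, Kpre_le 𝒞 hu, rfl⟩
    · exact ⟨y i, hy i, rfl⟩
  let R := Submodule.span (ZMod 3) G
  have hR : ∀ u ∈ 𝒞, red α β u ∈ R := by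
    intro u hu
    have : Kpre 𝒞 ⊔ AddSubgroup.closure (Set.range y) ≤ R.toAddSubgroup.comap (red α β) := by
      refine sup_le ?_ ?_
      · intro v hv
        exact Submodule.subset_span (Or.inl ⟨v, hv, rfl⟩)
      · rw [AddSubgroup.closure_le]
        rintro _ ⟨i, rfl⟩
        exact Submodule.subset_span (Or.inr ⟨i, rfl⟩)
    exact this (hC hu)
  have h2 : R * R ≤ W := by
    rw [Submodule.span_mul_span, Submodule.span_le]
    rintro _ ⟨g, hg, h, hh, rfl⟩
    obtain ⟨v, hv, hv'⟩ := hG h hh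
    obtain ⟨u, hu, hu'⟩ := hG g hg
    show g * h ∈ W
    rcases hg with ⟨u, hu, rfl⟩ | ⟨i, rfl⟩
    · rw [← hv']
      exact hKW (prods_mem 𝒞 hu hv).1
    rcases hh with ⟨v, hv, rfl⟩ | ⟨j, rfl⟩
    · rw [← hu', mul_comm]
      exact hKW (prods_mem 𝒞 hv hu).1
    by_cases hij : i = j
    · subst hij
      rw [← cub_sq]; exact hcub _
    · exact hquad ⟨s(i, j), by simpa using hij⟩
  have h3 : R * R * R ≤ W := by
    rw [Submodule.span_mul_span, Submodule.span_mul_span, Submodule.span_le]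
    rintro _ ⟨_, ⟨f, hf, g, hg, rfl⟩, h, hh, rfl⟩
    obtain ⟨w, hw, hw'⟩ := hG h hh
    obtain ⟨v, hv, hv'⟩ := hG g hg
    obtain ⟨u, hu, hu'⟩ := hG f hf
    show f * g * h ∈ W
    rcases hf with ⟨u, hu, rfl⟩ | ⟨i, rfl⟩
    · rw [← hv', ← hw']
      exact hKW (triple_mem 𝒞 hu hv hw)
    rcases hg with ⟨v, hv, rfl⟩ | ⟨j, rfl⟩
    · rw [← hu', ← hw', mul_comm (red α β u)]
      exact hKW (triple_mem 𝒞 hv hu hw)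
    rcases hh with ⟨w, hw, rfl⟩ | ⟨l, rfl⟩
    · rw [← hu', ← hv', mul_comm, ← mul_assoc]
      exact hKW (triple_mem 𝒞 hw hu hv)
    rcases cub_prod a i j l with h | h
    · rw [← h]; exact hcub _
    · rw [h]; exact hKW (hred _ (hy i))
  intro u hu v hv
  have hu' := hR u hu
  have hv' := hR v hv
  have e : P (red α β u) (red α β v) = -(red α β u * red α β v * red α β u
      + red α β u * red α β v * red α β v + red α β u * red α β v) := by
    unfold P; ring
  rw [e]
  exact neg_mem (add_mem (add_mem (h3 (Submodule.mul_mem_mul (Submodule.mul_mem_mul hu' hv') hu'))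
    (h3 (Submodule.mul_mem_mul (Submodule.mul_mem_mul hu' hv') hv')))
    (h2 (Submodule.mul_mem_mul hu' hv')))

lemma span_le_M {k : ℕ} (y : Fin k → U α β) (hy : ∀ i, y i ∈ 𝒞)
    (hC : 𝒞 ≤ Kpre 𝒞 ⊔ AddSubgroup.closure (Set.range y)) :
    Submodule.span (ZMod 3) (Gray3 α β '' (𝒞 : Set (U α β))) ≤ M 𝒞 y := by
  have hP := prod_le 𝒞 y hy hC
  let A : AddSubgroup (U α β) :=
    { carrier := {u | u ∈ 𝒞 ∧ Gray3 α β u ∈ M 𝒞 y}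
      zero_mem' := ⟨zero_mem _, by rw [Gray_zero]; exact zero_mem _⟩
      add_mem' := by
        rintro u v ⟨hu, hu'⟩ ⟨hv, hv'⟩
        refine ⟨add_mem hu hv, ?_⟩
        rw [Gray_add]
        exact add_mem (add_mem hu' hv') (hP u hu v hv)
      neg_mem' := by
        rintro u ⟨hu, hu'⟩
        refine ⟨neg_mem hu, ?_⟩
        rw [Gray_neg]
        exact neg_mem (add_mem hu' (hP u hu _ (neg_mem hu))) }
  have hA : 𝒞 ≤ A := by
    refine hC.trans (sup_le ?_ ?_)
    · intro u hu
      exact ⟨Kpre_le 𝒞 hu, Submodule.mem_sup_left (Submodule.mem_sup_left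
        (Submodule.mem_sup_left hu))⟩
    · rw [AddSubgroup.closure_le]
      rintro _ ⟨i, rfl⟩
      exact ⟨hy i, Submodule.mem_sup_left (Submodule.mem_sup_left
        (Submodule.mem_sup_right (Submodule.subset_span ⟨i, rfl⟩)))⟩
  rw [Submodule.span_le]
  rintro _ ⟨u, hu, rfl⟩
  exact (hA hu).2

lemma Gray_Kpre : Gray3 α β '' (Kpre 𝒞 : Set (U α β)) =
    kernelSet (Gray3 α β '' (𝒞 : Set (U α β))) := by
  ext z
  constructor
  · rintro ⟨u, hu, rfl⟩
    exact hu
  · intro hz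
    obtain ⟨u, hu, rfl⟩ := Ksub_sub (zero_mem_C 𝒞) hz
    exact ⟨u, hz, rfl⟩

end
end GrayAux

open GrayAux in
/-- Rank bounds in terms of the kernel parameter `k̄`: if `k̄ = 0` the code is linear
and `rank(C) = γ + 2δ`; if `k̄ ≥ 1` then
`γ + 2δ + 1 ≤ rank(C) ≤ γ + 2δ + C(k̄,2) + C(k̄+2,3)`. -/
theorem rank_bounds_of_kernel (α β γ δ kbar : ℕ)
    (𝒞 : AddSubgroup ((Fin α → ZMod 3) × (Fin β → ZMod 9)))
    (e : 𝒞 ≃+ (Fin γ → ZMod 3) × (Fin δ → ZMod 9))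
    (hk : kbar ≤ δ)
    (hker : Nat.card
        (kernelSet (Gray3 α β '' (𝒞 : Set ((Fin α → ZMod 3) × (Fin β → ZMod 9))))) =
      3 ^ (γ + 2 * δ - kbar)) :
    (kbar = 0 →
      Module.finrank (ZMod 3)
          (Submodule.span (ZMod 3)
            (Gray3 α β '' (𝒞 : Set ((Fin α → ZMod 3) × (Fin β → ZMod 9))))) =
        γ + 2 * δ) ∧
    (1 ≤ kbar →
      γ + 2 * δ + 1 ≤
          Module.finrank (ZMod 3)
            (Submodule.span (ZMod 3)
              (Gray3 α β '' (𝒞 : Set ((Fin α → ZMod 3) × (Fin β → ZMod 9))))) ∧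
        Module.finrank (ZMod 3)
            (Submodule.span (ZMod 3)
              (Gray3 α β '' (𝒞 : Set ((Fin α → ZMod 3) × (Fin β → ZMod 9))))) ≤
          γ + 2 * δ + Nat.choose kbar 2 + Nat.choose (kbar + 2) 3) := by
  set C := Gray3 α β '' (𝒞 : Set ((Fin α → ZMod 3) × (Fin β → ZMod 9))) with hCdef
  have hcC : Nat.card 𝒞 = 3 ^ (γ + 2 * δ) := card_C 𝒞 e
  have hcC' : Nat.card C = 3 ^ (γ + 2 * δ) := by
    rw [← hcC]; exact Nat.card_image_of_injective Gray_inj _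
  have hcK : Nat.card (Ksub C) = 3 ^ (γ + 2 * δ - kbar) := hker
  have hcKp : Nat.card (Kpre 𝒞) = 3 ^ (γ + 2 * δ - kbar) := by
    rw [← hker, ← Gray_Kpre]; exact (Nat.card_image_of_injective Gray_inj _).symm
  have hfK : Module.finrank (ZMod 3) (Ksub C) = γ + 2 * δ - kbar := by
    have := Module.natCard_eq_pow_finrank (K := ZMod 3) (V := Ksub C)
    rw [hcK, Nat.card_zmod] at this
    exact (Nat.pow_right_injective (by norm_num : 2 ≤ 3) this).symm
  have hcS := Module.natCard_eq_pow_finrank (K := ZMod 3) (V := Submodule.span (ZMod 3) C)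
  rw [Nat.card_zmod] at hcS
  have hle : γ + 2 * δ ≤ Module.finrank (ZMod 3) (Submodule.span (ZMod 3) C) := by
    have h : Nat.card C ≤ Nat.card (Submodule.span (ZMod 3) C) :=
      Nat.card_mono (Set.toFinite _) Submodule.subset_span
    rw [hcC', hcS] at h
    exact (Nat.pow_le_pow_iff_right (by norm_num)).1 h
  obtain ⟨y, hy, hyC⟩ := exists_gens 𝒞 (by omega : kbar ≤ γ + 2 * δ) hcC hcKp
  have hub := (Submodule.finrank_mono (span_le_M 𝒞 y hy hyC)).trans (finrank_M 𝒞 y)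
  rw [← hCdef, hfK] at hub
  refine ⟨?_, fun h1 => ⟨?_, by omega⟩⟩
  · rintro rfl
    simp at hub
    omega
  · by_contra hlt
    have heq : Module.finrank (ZMod 3) (Submodule.span (ZMod 3) C) = γ + 2 * δ := by omega
    have hCS : C = (Submodule.span (ZMod 3) C : Set _) := by
      refine Set.eq_of_subset_of_ncard_le Submodule.subset_span ?_ (Set.toFinite _)
      show Nat.card (Submodule.span (ZMod 3) C) ≤ Nat.card C
      rw [hcS, heq, hcC']
    have hKC : Submodule.span (ZMod 3) C ≤ Ksub C := by
      intro x hx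
      rw [mem_Ksub]
      show (fun c => x + c) '' C = C
      rw [hCS]
      ext z
      constructor
      · rintro ⟨c, hc, rfl⟩
        exact add_mem hx hc
      · intro hz
        exact ⟨z - x, sub_mem hz hx, by simp⟩
    have := Submodule.finrank_mono hKC
    omega
end

section
/- Let α, β, γ, δ, κ be natural numbers satisfying α + β > 0, 0 < γ + δ ≤ β + κ, and κ ≤ min(α, γ), and let k̄, r̄ be natural numbers. Then there exists an additive subgroup 𝒞 of (Fin α → ZMod 3) × (Fin β → ZMod 9) with 𝒞 ≃+ (Fin γ → ZMod 3) × (Fin δ → ZMod 9), with the ZMod 3-dimension of the projection onto the first α coordinates of the order-3 subcode {u ∈ 𝒞 : 3 • u = 0} equal to κ, with Nat.card (K(Φ '' 𝒞)) = 3^(γ + 2δ − k̄), and with Module.finrank (ZMod 3) (Submodule.span (ZMod 3) (Φ '' 𝒞)) = γ + 2δ + r̄, if and only if either (1 ≤ k̄ ≤ δ and 1 ≤ r̄ ≤ min(β − (γ − κ) − δ, choose(k̄, 2) + choose(k̄+2, 3))) or (k̄ = 0 and r̄ = 0). -/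
/-- The parameter `κ`: the `ZMod 3`-dimension of the projection onto the first `α`
coordinates of the order-3 subcode of `𝒞`. -/
noncomputable def kappa3 (α β : ℕ)
    (𝒞 : AddSubgroup ((Fin α → ZMod 3) × (Fin β → ZMod 9))) : ℕ :=
  Module.finrank (ZMod 3)
    (Submodule.span (ZMod 3)
      (Prod.fst '' {u : (Fin α → ZMod 3) × (Fin β → ZMod 9) | u ∈ 𝒞 ∧ 3 • u = 0}))


/-! ## Digits of elements of `ZMod 9` -/

/-- The low ternary digit. -/
def d1 (θ : ZMod 9) : ZMod 3 := ((θ.val % 3 : ℕ) : ZMod 3)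

/-- The high ternary digit. -/
def d2 (θ : ZMod 9) : ZMod 3 := ((θ.val / 3 : ℕ) : ZMod 3)

/-- The digit lift. -/
def lf (a : ZMod 3) : ZMod 9 := ((a.val : ℕ) : ZMod 9)

/-- The carry polynomial. -/
def cy (a b : ZMod 3) : ZMod 3 := -(a * b + a ^ 2 * b + a * b ^ 2)

lemma d1_add : ∀ u v : ZMod 9, d1 (u + v) = d1 u + d1 v := by decide
lemma d2_add : ∀ u v : ZMod 9, d2 (u + v) = d2 u + d2 v + cy (d1 u) (d1 v) := by decide
lemma d1_mul : ∀ u v : ZMod 9, d1 (u * v) = d1 u * d1 v := by decide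
lemma d1_zero : d1 0 = 0 := by decide
lemma d2_zero : d2 0 = 0 := by decide
lemma d1_lf : ∀ a : ZMod 3, d1 (lf a) = a := by decide
lemma d2_lf : ∀ a : ZMod 3, d2 (lf a) = 0 := by decide
lemma d1_three_mul : ∀ a : ZMod 9, d1 (3 * a) = 0 := by decide
lemma d2_three_mul : ∀ a : ZMod 9, d2 (3 * a) = d1 a := by decide
lemma three_mul_eq_zero_iff : ∀ a : ZMod 9, 3 * a = 0 ↔ d1 a = 0 := by decide
lemma cy_zero_left : ∀ a, cy 0 a = 0 := by decide
lemma cy_zero_right : ∀ a, cy a 0 = 0 := by decide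
lemma lf_zero : lf 0 = 0 := by decide
lemma digit_decomp : ∀ a : ZMod 9, a = 3 * lf (d2 a) + lf (d1 a) := by decide
lemma digit_ext {a b : ZMod 9} (h1 : d1 a = d1 b) (h2 : d2 a = d2 b) : a = b := by
  rw [digit_decomp a, digit_decomp b, h1, h2]
lemma three_nsmul_zmod3 : ∀ a : ZMod 3, 3 • a = 0 := by decide
lemma three_nsmul_nine : ∀ a : ZMod 9, 3 • a = 3 * a := by decide

/-- `d1` as an additive hom. -/
def d1Hom : ZMod 9 →+ ZMod 3 := ⟨⟨d1, d1_zero⟩, d1_add⟩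

lemma d1_sum {ι : Type*} (s : Finset ι) (f : ι → ZMod 9) :
    d1 (∑ i ∈ s, f i) = ∑ i ∈ s, d1 (f i) := map_sum d1Hom f s

lemma gray3_apply (θ : ZMod 9) (i : Fin 3) :
    gray3 θ i = d2 θ + d1 θ * ((i : ℕ) : ZMod 3) := rfl

lemma gray3_injective : Function.Injective gray3 := by
  intro a b h
  have h0 := congrFun h 0
  have h1 := congrFun h 1
  simp only [gray3_apply] at h0 h1
  simp at h0 h1
  rw [h0] at h1
  exact digit_ext (by simpa using h1) h0

section code

variable {α β : ℕ}

/-- The ambient group. -/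
abbrev Amb (α β : ℕ) := (Fin α → ZMod 3) × (Fin β → ZMod 9)

/-- The ambient vector space of the Gray image. -/
abbrev GV (α β : ℕ) := (Fin α → ZMod 3) × (Fin β → Fin 3 → ZMod 3)

lemma Gray3_injective : Function.Injective (Gray3 α β) := by
  intro a b h
  have h1 : (Gray3 α β a).1 = (Gray3 α β b).1 := by rw [h]
  have h2 : (Gray3 α β a).2 = (Gray3 α β b).2 := by rw [h]
  exact Prod.ext h1 (funext fun j => gray3_injective (congrFun h2 j))

/-- The carry vector of two words. -/
def car (u w : Amb α β) : Amb α β :=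
  (0, fun j => 3 * lf (cy (d1 (u.2 j)) (d1 (w.2 j))))

lemma Gray3_zero : Gray3 α β 0 = 0 := by
  refine Prod.ext rfl ?_
  funext j i
  simp [Gray3, gray3_apply, d1_zero, d2_zero]

lemma Gray3_add (u w : Amb α β) :
    Gray3 α β (u + w) = Gray3 α β u + Gray3 α β w + Gray3 α β (car u w) := by
  refine Prod.ext ?_ ?_
  · simp [Gray3, car]
  · funext j i
    simp only [Gray3, gray3_apply, car, Prod.snd_add, Pi.add_apply, d1_add, d2_add,
      d1_three_mul, d2_three_mul, d1_lf]
    ring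

lemma three_amb_iff (o : Amb α β) : 3 • o = 0 ↔ ∀ j, d1 (o.2 j) = 0 := by
  constructor
  · intro h j
    have : (3 • o).2 j = 0 := by rw [h]; rfl
    rw [← three_mul_eq_zero_iff, ← three_nsmul_nine]
    exact this
  · intro h
    refine Prod.ext (funext fun j => three_nsmul_zmod3 _) (funext fun j => ?_)
    have : 3 • (o.2 j) = 0 := by rw [three_nsmul_nine, three_mul_eq_zero_iff]; exact h j
    exact this

lemma three_car (u w : Amb α β) : 3 • car u w = 0 :=
  (three_amb_iff _).2 fun j => by simp [car, d1_three_mul]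

lemma car_of_three (u : Amb α β) {o : Amb α β} (h : 3 • o = 0) : car u o = 0 := by
  rw [three_amb_iff] at h
  refine Prod.ext rfl (funext fun j => ?_)
  simp [car, h, cy_zero_right, lf_zero]

lemma car_comm (u w : Amb α β) : car u w = car w u := by
  refine Prod.ext rfl (funext fun j => ?_)
  simp only [car]
  congr 2
  simp only [cy]; ring

lemma Gray3_add_three (u : Amb α β) {o : Amb α β} (h : 3 • o = 0) :
    Gray3 α β (u + o) = Gray3 α β u + Gray3 α β o := by
  rw [Gray3_add, car_of_three u h, Gray3_zero, add_zero]

lemma Gray3_add' (u w : Amb α β) :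
    Gray3 α β u + Gray3 α β w = Gray3 α β (u + w - car u w) := by
  have := Gray3_add_three (u + w - car u w) (three_car u w)
  rw [sub_add_cancel, Gray3_add] at this
  exact add_right_cancel this

/-- The part of the code giving the kernel. -/
def kerPart (𝒞 : AddSubgroup (Amb α β)) : Set (Amb α β) :=
  {u | u ∈ 𝒞 ∧ ∀ w ∈ 𝒞, car u w ∈ 𝒞}

lemma kernel_eq (𝒞 : AddSubgroup (Amb α β)) :
    kernelSet (Gray3 α β '' (𝒞 : Set (Amb α β))) = Gray3 α β '' kerPart 𝒞 := by
  ext x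
  constructor
  · intro hx
    have hx : (fun c => x + c) '' (Gray3 α β '' (𝒞 : Set (Amb α β))) = _ := hx
    have key : ∀ w ∈ 𝒞, x + Gray3 α β w ∈ Gray3 α β '' (𝒞 : Set (Amb α β)) := by
      intro w hw
      rw [← hx]
      exact ⟨_, ⟨w, hw, rfl⟩, rfl⟩
    have h0 := key 0 𝒞.zero_mem
    rw [Gray3_zero, add_zero] at h0
    obtain ⟨u, hu, rfl⟩ := h0
    refine ⟨u, ⟨hu, fun w hw => ?_⟩, rfl⟩
    obtain ⟨v, hv, h⟩ := key w hw
    rw [Gray3_add'] at h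
    have := Gray3_injective h
    have h2 : car u w = u + w - v := by rw [this]; abel
    rw [h2]
    exact 𝒞.sub_mem (𝒞.add_mem hu hw) hv
  · rintro ⟨u, ⟨hu, hc⟩, rfl⟩
    show (fun c => Gray3 α β u + c) '' (Gray3 α β '' (𝒞 : Set (Amb α β))) = _
    apply Set.eq_of_subset_of_ncard_le
    · rintro _ ⟨_, ⟨w, hw, rfl⟩, rfl⟩
      refine ⟨u + w - car u w, 𝒞.sub_mem (𝒞.add_mem hu hw) (hc w hw), ?_⟩
      exact (Gray3_add' u w).symm
    · rw [Set.ncard_image_of_injective _ (add_right_injective _)]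
    · exact Set.toFinite _

lemma card_kernel (𝒞 : AddSubgroup (Amb α β)) :
    Nat.card (kernelSet (Gray3 α β '' (𝒞 : Set (Amb α β)))) = Nat.card (kerPart 𝒞) := by
  rw [kernel_eq]
  exact Nat.card_image_of_injective Gray3_injective _

end code

/-! ## Polynomial functions of degree at most three -/

section poly

variable {k : ℕ}

/-- Functions on `F₃^k`. -/
abbrev Fn (k : ℕ) := (Fin k → ZMod 3) → ZMod 3

/-- The monomial functions. -/
def mono (k : ℕ) : Sym (Fin k) 2 ⊕ Sym (Fin k) 3 → Fn k
  | Sum.inl m => fun x => ((m : Multiset (Fin k)).map x).prod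
  | Sum.inr m => fun x => ((m : Multiset (Fin k)).map x).prod

/-- The coordinate functions. -/
def co (i : Fin k) : Fn k := fun x => x i

/-- The space of polynomial functions of degree at most three without constant term. -/
def PolyThree (k : ℕ) : Submodule (ZMod 3) (Fn k) := Submodule.span (ZMod 3) (Set.range (mono k))

/-- Linear forms. -/
def LinF (k : ℕ) : Submodule (ZMod 3) (Fn k) := Submodule.span (ZMod 3) (Set.range (co (k := k)))

lemma co_mul_mem (i j : Fin k) : co i * co j ∈ PolyThree k := by
  refine Submodule.subset_span ⟨Sum.inl ⟨{i, j}, rfl⟩, ?_⟩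
  funext x
  simp [mono, co]

lemma co_mul_mul_mem (i j l : Fin k) : co i * co j * co l ∈ PolyThree k := by
  refine Submodule.subset_span ⟨Sum.inr ⟨{i, j, l}, rfl⟩, ?_⟩
  funext x
  simp [mono, co, mul_assoc]

lemma cube_zmod3 : ∀ a : ZMod 3, a * a * a = a := by decide

lemma co_mem (i : Fin k) : co i ∈ PolyThree k := by
  have := co_mul_mul_mem i i i
  have h : co i * co i * co i = co i := by
    funext x
    exact cube_zmod3 _
  rwa [h] at this

lemma lin_le : LinF k ≤ PolyThree k := by
  refine Submodule.span_le.2 ?_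
  rintro _ ⟨i, rfl⟩
  exact co_mem i

lemma lin_mul_le : LinF k * LinF k ≤ PolyThree k := by
  rw [LinF, Submodule.span_mul_span, Submodule.span_le]
  rintro _ ⟨_, ⟨i, rfl⟩, _, ⟨j, rfl⟩, rfl⟩
  exact co_mul_mem i j

lemma lin_mul_mul_le : LinF k * LinF k * LinF k ≤ PolyThree k := by
  rw [LinF, Submodule.span_mul_span, Submodule.span_mul_span, Submodule.span_le]
  rintro _ ⟨_, ⟨_, ⟨i, rfl⟩, _, ⟨j, rfl⟩, rfl⟩, _, ⟨l, rfl⟩, rfl⟩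
  exact co_mul_mul_mem i j l

lemma cy_lin_mem {a b : Fn k} (ha : a ∈ LinF k) (hb : b ∈ LinF k) :
    (fun x => cy (a x) (b x)) ∈ PolyThree k := by
  have h : (fun x => cy (a x) (b x)) = -(a * b + a * a * b + a * b * b) := by
    funext x
    simp only [cy, Pi.neg_apply, Pi.add_apply, Pi.mul_apply]
    ring
  rw [h]
  refine Submodule.neg_mem _ (Submodule.add_mem _ (Submodule.add_mem _ ?_ ?_) ?_)
  · exact lin_mul_le (Submodule.mul_mem_mul ha hb)
  · exact lin_mul_mul_le (Submodule.mul_mem_mul (Submodule.mul_mem_mul ha ha) hb)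
  · exact lin_mul_mul_le (Submodule.mul_mem_mul (Submodule.mul_mem_mul ha hb) hb)

lemma d2_lf_mul : ∀ (a : ZMod 3) (t : ZMod 9), d2 (lf a * t) =
    d2 (lf 1 * t) * a + (d2 (lf 2 * t) - 2 * d2 (lf 1 * t)) * (a * a - a) * 2 := by decide

lemma d1_comb_mem (θ : Fin k → ZMod 9) (s : Finset (Fin k)) :
    (fun x : Fin k → ZMod 3 => d1 (∑ i ∈ s, lf (x i) * θ i)) ∈ LinF k := by
  have h : (fun x : Fin k → ZMod 3 => d1 (∑ i ∈ s, lf (x i) * θ i)) =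
      ∑ i ∈ s, d1 (θ i) • co i := by
    funext x
    simp [d1_sum, d1_mul, d1_lf, co, Finset.sum_apply, mul_comm]
  rw [h]
  exact Submodule.sum_mem _ fun i _ => Submodule.smul_mem _ _ (Submodule.subset_span ⟨i, rfl⟩)

lemma d2_comb_mem (θ : Fin k → ZMod 9) (s : Finset (Fin k)) :
    (fun x : Fin k → ZMod 3 => d2 (∑ i ∈ s, lf (x i) * θ i)) ∈ PolyThree k := by
  induction s using Finset.induction_on with
  | empty =>
    have : (fun x : Fin k → ZMod 3 => d2 (∑ i ∈ (∅ : Finset (Fin k)), lf (x i) * θ i)) = 0 := by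
      funext x; simp [d2_zero]
    rw [this]; exact Submodule.zero_mem _
  | insert j s hj ih =>
    have : (fun x : Fin k → ZMod 3 => d2 (∑ i ∈ insert j s, lf (x i) * θ i)) =
        (d2 (lf 1 * θ j) • co j +
          ((d2 (lf 2 * θ j) - 2 * d2 (lf 1 * θ j)) * 2) • (co j * co j - co j)) +
        (fun x => d2 (∑ i ∈ s, lf (x i) * θ i)) +
        (fun x => cy (d1 (θ j) * co j x) (d1 (∑ i ∈ s, lf (x i) * θ i))) := by
      funext x
      rw [Finset.sum_insert hj, d2_add, d2_lf_mul]
      simp only [Pi.add_apply, Pi.smul_apply, Pi.sub_apply, Pi.mul_apply, co, smul_eq_mul, d1_mul,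
        d1_lf]
      rw [mul_comm (x j) (d1 (θ j))]
      ring
    rw [this]
    refine Submodule.add_mem _ (Submodule.add_mem _ (Submodule.add_mem _ ?_ ?_) ih) ?_
    · exact Submodule.smul_mem _ _ (co_mem j)
    · exact Submodule.smul_mem _ _ (Submodule.sub_mem _ (co_mul_mem j j) (co_mem j))
    · refine cy_lin_mem (a := d1 (θ j) • co j) ?_ (d1_comb_mem θ s)
      exact Submodule.smul_mem _ _ (Submodule.subset_span ⟨j, rfl⟩)

lemma card_mono (k : ℕ) : Fintype.card (Sym (Fin k) 2 ⊕ Sym (Fin k) 3) =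
    k + (Nat.choose k 2 + Nat.choose (k + 2) 3) := by
  rw [Fintype.card_sum, Sym.card_sym_eq_choose, Sym.card_sym_eq_choose, Fintype.card_fin]
  have h1 : k + 2 - 1 = k + 1 := by omega
  have h2 : k + 3 - 1 = k + 2 := by omega
  rw [h1, h2, Nat.choose_succ_succ' k 1, Nat.choose_one_right]
  ring

/-- Reduced exponent vector. -/
noncomputable def redExp (k : ℕ) : Sym (Fin k) 2 ⊕ Sym (Fin k) 3 → (Fin k →₀ ℕ)
  | Sum.inl m => Multiset.toFinsupp (m : Multiset (Fin k))
  | Sum.inr m => open Classical in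
      if h : ∃ i, (m : Multiset (Fin k)) = Multiset.replicate 3 i then Finsupp.single h.choose 1
      else Multiset.toFinsupp (m : Multiset (Fin k))

lemma redExp_inr (m : Sym (Fin k) 3) :
    (∃ i, (m : Multiset (Fin k)) = Multiset.replicate 3 i ∧
      redExp k (Sum.inr m) = Finsupp.single i 1) ∨
    ((¬ ∃ i, (m : Multiset (Fin k)) = Multiset.replicate 3 i) ∧
      redExp k (Sum.inr m) = Multiset.toFinsupp (m : Multiset (Fin k))) := by
  by_cases h : ∃ i, (m : Multiset (Fin k)) = Multiset.replicate 3 i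
  · left
    exact ⟨h.choose, h.choose_spec, by simp only [redExp]; rw [dif_pos h]⟩
  · right
    exact ⟨h, by simp only [redExp]; rw [dif_neg h]⟩

lemma redExp_injective : Function.Injective (redExp k) := by
  have hs : ∀ (m : Multiset (Fin k)), (Finsupp.toMultiset (Multiset.toFinsupp m)).card = m.card := by
    intro m; simp
  have hs1 : ∀ i : Fin k, (Finsupp.toMultiset (Finsupp.single i 1)).card = 1 := by
    intro i; simp
  have c2 : ∀ m : Sym (Fin k) 2, (m : Multiset (Fin k)).card = 2 := fun m => m.2
  have c3 : ∀ m : Sym (Fin k) 3, (m : Multiset (Fin k)).card = 3 := fun m => m.2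
  rintro (m | m) (n | n) h
  · have := Multiset.toFinsupp.injective h
    exact congrArg _ (Sym.coe_injective this)
  · exfalso
    have h' := congrArg (fun f => (Finsupp.toMultiset f).card) h
    rcases redExp_inr n with ⟨i, _, e⟩ | ⟨_, e⟩ <;> rw [e] at h' <;>
      simp only [redExp, hs, hs1, c2, c3] at h' <;> omega
  · exfalso
    have h' := congrArg (fun f => (Finsupp.toMultiset f).card) h
    rcases redExp_inr m with ⟨i, _, e⟩ | ⟨_, e⟩ <;> rw [e] at h' <;>
      simp only [redExp, hs, hs1, c2, c3] at h' <;> omega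
  · have h' := congrArg (fun f => (Finsupp.toMultiset f).card) h
    rcases redExp_inr m with ⟨i, hm, e⟩ | ⟨_, e⟩ <;>
      rcases redExp_inr n with ⟨j, hn, e'⟩ | ⟨_, e'⟩ <;> rw [e, e'] at h' h
    · have : i = j := by
        by_contra hij
        have := DFunLike.congr_fun h i
        simp [Ne.symm hij] at this
      subst this
      exact congrArg _ (Sym.coe_injective (hm.trans hn.symm))
    · simp only [hs, hs1, c3] at h'; omega
    · simp only [hs, hs1, c3] at h'; omega
    · exact congrArg _ (Sym.coe_injective (Multiset.toFinsupp.injective h))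

lemma redExp_le (j : Sym (Fin k) 2 ⊕ Sym (Fin k) 3) (i : Fin k) : redExp k j i ≤ 2 := by
  rcases j with m | m
  · simp only [redExp, Multiset.toFinsupp_apply]
    exact (Multiset.count_le_card _ _).trans m.2.le
  · rcases redExp_inr m with ⟨l, hm, e⟩ | ⟨hm, e⟩ <;> rw [e]
    · rw [Finsupp.single_apply]; split_ifs <;> omega
    · rw [Multiset.toFinsupp_apply]
      by_contra hc
      have h1 := Multiset.count_le_card i (m : Multiset (Fin k))
      have c3 : (m : Multiset (Fin k)).card = 3 := m.2
      apply hm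
      refine ⟨i, ?_⟩
      have h3 : Multiset.count i (m : Multiset (Fin k)) = (m : Multiset (Fin k)).card := by omega
      rw [Multiset.count_eq_card] at h3
      rw [Multiset.eq_replicate]
      exact ⟨c3, fun b hb => (h3 b hb).symm⟩

lemma mono_eq (j : Sym (Fin k) 2 ⊕ Sym (Fin k) 3) (x : Fin k → ZMod 3) :
    mono k j x = MvPolynomial.eval x (MvPolynomial.monomial (redExp k j) 1) := by
  have key : ∀ m : Multiset (Fin k), (m.map x).prod =
      MvPolynomial.eval x (MvPolynomial.monomial (Multiset.toFinsupp m) 1) := by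
    intro m
    rw [MvPolynomial.eval_monomial, one_mul, Finsupp.prod, Finset.prod_multiset_map_count]
    simp
  rcases j with m | m
  · exact key _
  · rcases redExp_inr m with ⟨l, hm, e⟩ | ⟨hm, e⟩ <;> rw [e]
    · simp only [mono, hm, MvPolynomial.eval_monomial]
      simp only [Multiset.map_replicate, Multiset.prod_replicate, one_mul]
      rw [Finsupp.prod_single_index (by simp), pow_one, pow_succ, pow_succ, pow_one, cube_zmod3]
    · exact key _

lemma mono_indep (k : ℕ) : LinearIndependent (ZMod 3) (mono k) := by
  have : Fact (Nat.Prime 3) := ⟨Nat.prime_three⟩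
  rw [Fintype.linearIndependent_iff]
  intro c hc j
  have h0 : (∑ i, MvPolynomial.monomial (redExp k i) (c i)) = 0 := by
    apply MvPolynomial.eq_zero_of_eval_eq_zero
    · intro v
      have := congrFun hc v
      simp only [Finset.sum_apply, Pi.smul_apply, mono_eq, smul_eq_mul, Pi.zero_apply] at this
      rw [map_sum, ← this]
      refine Finset.sum_congr rfl fun i _ => ?_
      simp [MvPolynomial.eval_monomial]
    · refine Submodule.sum_mem _ fun i _ => ?_
      rw [MvPolynomial.mem_restrictDegree]
      intro s hs n
      have := MvPolynomial.support_monomial_subset hs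
      rw [Finset.mem_singleton] at this
      rw [this, ZMod.card]
      exact redExp_le i n
  have h1 := congrArg (MvPolynomial.coeff (redExp k j)) h0
  rw [MvPolynomial.coeff_sum] at h1
  simp only [MvPolynomial.coeff_monomial, redExp_injective.eq_iff] at h1
  simpa using h1

lemma finrank_poly (k : ℕ) : Module.finrank (ZMod 3) (PolyThree k) =
    k + (Nat.choose k 2 + Nat.choose (k + 2) 3) := by
  have : Fact (Nat.Prime 3) := ⟨Nat.prime_three⟩
  rw [PolyThree, finrank_span_eq_card (mono_indep k), card_mono]

end poly

/-! ## Necessity -/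

section necessity

variable {α β : ℕ}

lemma exists_gens {A : Type*} [AddCommGroup A] [Finite A] (G H : AddSubgroup A) (hHG : H ≤ G)
    (h3 : ∀ g ∈ G, 3 • g ∈ H) (k : ℕ) (hc : Nat.card G = Nat.card H * 3 ^ k) :
    ∃ u : Fin k → A, (∀ i, u i ∈ G) ∧ ∀ g ∈ G, ∃ x : Fin k → ZMod 3,
      g - ∑ i, (x i).val • u i ∈ H := by
  have : Fact (Nat.Prime 3) := ⟨Nat.prime_three⟩
  let H' := H.addSubgroupOf G
  let Q := G ⧸ H'
  have hQ3 : ∀ q : Q, 3 • q = 0 := by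
    intro q
    induction q using QuotientAddGroup.induction_on with
    | H g =>
      rw [← QuotientAddGroup.mk_nsmul, QuotientAddGroup.eq_zero_iff]
      exact h3 g g.2
  let _ : Module (ZMod 3) Q := AddCommGroup.zmodModule hQ3
  have hcard : Nat.card Q = 3 ^ k := by
    have h1 := AddSubgroup.card_eq_card_quotient_mul_card_addSubgroup H'
    have h2 : Nat.card H' = Nat.card H :=
      Nat.card_congr (AddSubgroup.addSubgroupOfEquivOfLe hHG).toEquiv
    rw [h2, hc, mul_comm] at h1
    exact (Nat.eq_of_mul_eq_mul_right Nat.card_pos h1).symm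
  have hfin : Module.finrank (ZMod 3) Q = k := by
    have := Module.natCard_eq_pow_finrank (K := ZMod 3) (V := Q)
    rw [hcard, Nat.card_zmod] at this
    exact (Nat.pow_right_injective (le_refl 2 |>.trans (by norm_num)) this).symm
  let b := Module.finBasisOfFinrankEq (ZMod 3) Q hfin
  choose u hu using fun i => QuotientAddGroup.mk_surjective (b i)
  refine ⟨fun i => u i, fun i => (u i).2, fun g hg => ?_⟩
  refine ⟨fun i => b.repr (QuotientAddGroup.mk (⟨g, hg⟩ : G)) i, ?_⟩
  have h := b.sum_repr (QuotientAddGroup.mk (⟨g, hg⟩ : G))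
  have h' : ((⟨g, hg⟩ - ∑ i, (b.repr (QuotientAddGroup.mk (⟨g, hg⟩ : G)) i).val • u i : G) : Q) = 0 := by
    rw [QuotientAddGroup.mk_sub, sub_eq_zero]
    refine h.symm.trans ?_
    rw [QuotientAddGroup.mk_sum]
    refine Finset.sum_congr rfl fun i _ => ?_
    rw [QuotientAddGroup.mk_nsmul, hu]
    conv_lhs => rw [← ZMod.natCast_zmod_val (b.repr (QuotientAddGroup.mk (⟨g, hg⟩ : G)) i)]
    rw [Nat.cast_smul_eq_nsmul]
  rw [QuotientAddGroup.eq_zero_iff] at h'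
  have h'' := AddSubgroup.mem_addSubgroupOf.1 h'
  simpa using h''

lemma lf_add3 : ∀ a b : ZMod 3, 3 * lf (a + b) = 3 * lf a + 3 * lf b := by decide
lemma cy_cocycle : ∀ a b c : ZMod 3, cy a b + cy (a + b) c = cy b c + cy a (b + c) := by decide

lemma car_cocycle (u v w : Amb α β) : car u v + car (u + v) w = car v w + car u (v + w) := by
  refine Prod.ext rfl (funext fun j => ?_)
  simp only [car, Prod.snd_add, Pi.add_apply, d1_add, ← lf_add3, cy_cocycle]

lemma car_zero_left (w : Amb α β) : car 0 w = 0 := by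
  rw [car_comm]; exact car_of_three _ (by simp)

/-- The kernel part as a subgroup. -/
def kerSub (𝒞 : AddSubgroup (Amb α β)) : AddSubgroup (Amb α β) where
  carrier := kerPart 𝒞
  zero_mem' := ⟨𝒞.zero_mem, fun w _ => by rw [car_zero_left]; exact 𝒞.zero_mem⟩
  add_mem' := by
    rintro u v ⟨hu, hu'⟩ ⟨hv, hv'⟩
    refine ⟨𝒞.add_mem hu hv, fun w hw => ?_⟩
    have h : car (u + v) w = car v w + car u (v + w) - car u v := by
      rw [← car_cocycle]; abel
    rw [h]
    exact 𝒞.sub_mem (𝒞.add_mem (hv' w hw) (hu' _ (𝒞.add_mem hv hw))) (hu' v hv)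
  neg_mem' := by
    rintro u ⟨hu, hu'⟩
    refine ⟨𝒞.neg_mem hu, fun w hw => ?_⟩
    have h : car (-u) w = car u (-u) - car u (-u + w) := by
      have := car_cocycle u (-u) w
      rw [add_neg_cancel, car_zero_left, add_zero] at this
      rw [this]; abel
    rw [h]
    exact 𝒞.sub_mem (hu' _ (𝒞.neg_mem hu)) (hu' _ (𝒞.add_mem (𝒞.neg_mem hu) hw))

/-- The order-3 subcode. -/
def sub3 (𝒞 : AddSubgroup (Amb α β)) : AddSubgroup (Amb α β) where
  carrier := {u | u ∈ 𝒞 ∧ 3 • u = 0}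
  zero_mem' := ⟨𝒞.zero_mem, by simp⟩
  add_mem' := by
    rintro u v ⟨hu, hu'⟩ ⟨hv, hv'⟩
    exact ⟨𝒞.add_mem hu hv, by rw [smul_add, hu', hv', add_zero]⟩
  neg_mem' := by
    rintro u ⟨hu, hu'⟩
    exact ⟨𝒞.neg_mem hu, by rw [smul_neg, hu', neg_zero]⟩

lemma sub3_le_kerSub (𝒞 : AddSubgroup (Amb α β)) : sub3 𝒞 ≤ kerSub 𝒞 := by
  rintro u ⟨hu, h3⟩
  exact ⟨hu, fun w _ => by rw [car_comm, car_of_three _ h3]; exact 𝒞.zero_mem⟩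

lemma nine_amb (u : Amb α β) : 3 • 3 • u = 0 := by
  have h : ∀ a : ZMod 9, 3 • 3 • a = 0 := by decide
  have h' : ∀ a : ZMod 3, 3 • 3 • a = 0 := by decide
  exact Prod.ext (funext fun j => h' _) (funext fun j => h _)

lemma three_mem_sub3 {𝒞 : AddSubgroup (Amb α β)} {u : Amb α β} (hu : u ∈ 𝒞) : 3 • u ∈ sub3 𝒞 :=
  ⟨𝒞.nsmul_mem hu 3, nine_amb u⟩

/-- The kernel as a subspace. -/
def kerW (𝒞 : AddSubgroup (Amb α β)) : Submodule (ZMod 3) (GV α β) :=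
  AddSubgroup.toZModSubmodule 3
  { carrier := Gray3 α β '' kerPart 𝒞
    zero_mem' := ⟨0, (kerSub 𝒞).zero_mem, Gray3_zero⟩
    add_mem' := by
      rintro _ _ ⟨u, hu, rfl⟩ ⟨v, hv, rfl⟩
      refine ⟨u + v - car u v, ?_, (Gray3_add' u v).symm⟩
      exact (kerSub 𝒞).sub_mem ((kerSub 𝒞).add_mem hu hv)
        (sub3_le_kerSub 𝒞 ⟨hu.2 v hv.1, three_car u v⟩)
    neg_mem' := by
      rintro _ ⟨u, hu, rfl⟩
      refine ⟨-u + car u (-u), ?_, ?_⟩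
      · exact (kerSub 𝒞).add_mem ((kerSub 𝒞).neg_mem hu)
          (sub3_le_kerSub 𝒞 ⟨hu.2 _ (𝒞.neg_mem hu.1), three_car u _⟩)
      · rw [Gray3_add_three _ (three_car _ _), eq_neg_iff_add_eq_zero]
        have := Gray3_add u (-u)
        rw [add_neg_cancel, Gray3_zero] at this
        rw [this]; abel }

lemma mem_kerW {𝒞 : AddSubgroup (Amb α β)} {x : GV α β} :
    x ∈ kerW 𝒞 ↔ x ∈ Gray3 α β '' kerPart 𝒞 := Iff.rfl

lemma span_range_le {k : ℕ} (F : (Fin k → ZMod 3) → GV α β)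
    (hF1 : ∀ a, (fun x => (F x).1 a) ∈ PolyThree k)
    (hF2 : ∀ b i, (fun x => (F x).2 b i) ∈ PolyThree k) :
    Module.finrank (ZMod 3) (Submodule.span (ZMod 3) (Set.range F)) ≤
      k + (Nat.choose k 2 + Nat.choose (k + 2) 3) := by
  have : Fact (Nat.Prime 3) := ⟨Nat.prime_three⟩
  choose c1 hc1 using fun a => (Submodule.mem_span_range_iff_exists_fun _).1 (hF1 a)
  choose c2 hc2 using fun b i => (Submodule.mem_span_range_iff_exists_fun _).1 (hF2 b i)
  let w : (Sym (Fin k) 2 ⊕ Sym (Fin k) 3) → GV α β := fun j => (fun a => c1 a j, fun b i => c2 b i j)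
  have hle : Submodule.span (ZMod 3) (Set.range F) ≤ Submodule.span (ZMod 3) (Set.range w) := by
    rw [Submodule.span_le]
    rintro _ ⟨x, rfl⟩
    have : F x = ∑ j, mono k j x • w j := by
      refine Prod.ext (funext fun a => ?_) (funext fun b => funext fun i => ?_)
      · have := congrFun (hc1 a) x
        refine Eq.trans this.symm ?_
        simp [Prod.fst_sum, Finset.sum_apply, w, mul_comm]
      · have := congrFun (hc2 b i) x
        refine Eq.trans this.symm ?_
        simp [Prod.snd_sum, Finset.sum_apply, w, mul_comm]
    rw [SetLike.mem_coe, this]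
    exact Submodule.sum_mem _ fun j _ => Submodule.smul_mem _ _ (Submodule.subset_span ⟨j, rfl⟩)
  refine (Submodule.finrank_mono hle).trans ?_
  refine (finrank_range_le_card w).trans ?_
  rw [card_mono]

lemma comb_fst {k : ℕ} (u : Fin k → Amb α β) (x : Fin k → ZMod 3) (a : Fin α) :
    (∑ i, (x i).val • u i).1 a = ∑ i, x i * (u i).1 a := by
  rw [Prod.fst_sum, Finset.sum_apply]
  refine Finset.sum_congr rfl fun i _ => ?_
  change (x i).val • (u i).1 a = _
  rw [nsmul_eq_mul, ZMod.natCast_zmod_val]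

lemma comb_snd {k : ℕ} (u : Fin k → Amb α β) (x : Fin k → ZMod 3) (b : Fin β) :
    (∑ i, (x i).val • u i).2 b = ∑ i, lf (x i) * (u i).2 b := by
  rw [Prod.snd_sum, Finset.sum_apply]
  refine Finset.sum_congr rfl fun i _ => ?_
  change (x i).val • (u i).2 b = _
  rw [nsmul_eq_mul]
  rfl

lemma span_comb_le {k : ℕ} (u : Fin k → Amb α β) :
    Module.finrank (ZMod 3) (Submodule.span (ZMod 3)
      (Set.range fun x : Fin k → ZMod 3 => Gray3 α β (∑ i, (x i).val • u i))) ≤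
      k + (Nat.choose k 2 + Nat.choose (k + 2) 3) := by
  apply span_range_le
  · intro a
    have h : (fun x : Fin k → ZMod 3 => (Gray3 α β (∑ i, (x i).val • u i)).1 a) =
        ∑ i, (u i).1 a • co i := by
      funext x
      simp only [Gray3, comb_fst]
      simp [Finset.sum_apply, co, mul_comm]
    rw [h]
    exact Submodule.sum_mem _ fun i _ => Submodule.smul_mem _ _ (co_mem i)
  · intro b i
    have h : (fun x : Fin k → ZMod 3 => (Gray3 α β (∑ i, (x i).val • u i)).2 b i) =
        (fun x => d2 (∑ l, lf (x l) * (u l).2 b)) +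
          (((i : ℕ) : ZMod 3)) • (fun x => d1 (∑ l, lf (x l) * (u l).2 b)) := by
      funext x
      simp only [Gray3, comb_snd, gray3_apply, Pi.add_apply, Pi.smul_apply, smul_eq_mul]
      ring
    rw [h]
    exact Submodule.add_mem _ (d2_comb_mem _ _)
      (Submodule.smul_mem _ _ (lin_le (d1_comb_mem (fun l => (u l).2 b) _)))

lemma card_sub3 {γ δ : ℕ} (𝒞 : AddSubgroup (Amb α β))
    (e : 𝒞 ≃+ (Fin γ → ZMod 3) × (Fin δ → ZMod 9)) : Nat.card (sub3 𝒞) = 3 ^ (γ + δ) := by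
  have h9 : Nat.card {θ : ZMod 9 // 3 • θ = 0} = 3 := by
    rw [Nat.card_eq_fintype_card]; decide
  have e1 : sub3 𝒞 ≃ {c : 𝒞 // 3 • c = 0} :=
    { toFun := fun u => ⟨⟨u.1, u.2.1⟩, Subtype.ext u.2.2⟩
      invFun := fun c => ⟨c.1.1, c.1.2, congrArg Subtype.val c.2⟩
      left_inv := fun _ => rfl
      right_inv := fun _ => rfl }
  have e2 : {c : 𝒞 // 3 • c = 0} ≃ {x : (Fin γ → ZMod 3) × (Fin δ → ZMod 9) // 3 • x = 0} :=
    e.toEquiv.subtypeEquiv fun c => by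
      constructor
      · intro h
        have := congrArg e h
        simpa using this
      · intro h
        apply e.injective
        simpa using h
  have e3 : {x : (Fin γ → ZMod 3) × (Fin δ → ZMod 9) // 3 • x = 0} ≃
      (Fin γ → ZMod 3) × (Fin δ → {θ : ZMod 9 // 3 • θ = 0}) :=
    { toFun := fun x => (x.1.1, fun i => ⟨x.1.2 i, congrFun (congrArg Prod.snd x.2) i⟩)
      invFun := fun y => ⟨(y.1, fun i => (y.2 i).1),
        Prod.ext (funext fun j => three_nsmul_zmod3 _) (funext fun i => (y.2 i).2)⟩
      left_inv := fun _ => rfl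
      right_inv := fun _ => rfl }
  rw [Nat.card_congr ((e1.trans e2).trans e3), Nat.card_prod, Nat.card_fun, Nat.card_fun, h9]
  simp [pow_add]

lemma card_code {γ δ : ℕ} (𝒞 : AddSubgroup (Amb α β))
    (e : 𝒞 ≃+ (Fin γ → ZMod 3) × (Fin δ → ZMod 9)) : Nat.card 𝒞 = 3 ^ (γ + 2 * δ) := by
  rw [Nat.card_congr e.toEquiv, Nat.card_prod, Nat.card_fun, Nat.card_fun]
  simp [pow_add, pow_mul]

end necessity

section necessity2

variable {α β : ℕ}

/-- Vectors with zero first part and constant blocks, together with a first part in `U`. -/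
def blockMap (α β : ℕ) (U : Submodule (ZMod 3) (Fin α → ZMod 3)) :
    (U × (Fin β → ZMod 3)) →ₗ[ZMod 3] GV α β where
  toFun p := (p.1, fun b _ => p.2 b)
  map_add' _ _ := rfl
  map_smul' _ _ := rfl

lemma Gray3_comb_mem (U : Submodule (ZMod 3) (Fin α → ZMod 3)) {k : ℕ} (u : Fin k → Amb α β)
    (x : Fin k → ZMod 3) :
    Gray3 α β (∑ i, (x i).val • u i) ∈ LinearMap.range (blockMap α β U) ⊔
      Submodule.span (ZMod 3) (Set.range fun i => Gray3 α β (u i)) := by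
  have h : Gray3 α β (∑ i, (x i).val • u i) =
      blockMap α β U (0, fun b => d2 ((∑ i, (x i).val • u i).2 b) - ∑ i, x i * d2 ((u i).2 b)) +
      ∑ i, x i • Gray3 α β (u i) := by
    refine Prod.ext (funext fun a => ?_) (funext fun b => funext fun j => ?_)
    · simp only [Gray3, comb_fst, blockMap]
      simp [Prod.fst_sum, Finset.sum_apply]
    · simp only [Gray3, blockMap]
      have h1 : d1 ((∑ i, (x i).val • u i).2 b) = ∑ i, x i * d1 ((u i).2 b) := by
        rw [comb_snd, d1_sum]
        exact Finset.sum_congr rfl fun i _ => by rw [d1_mul, d1_lf]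
      simp only [LinearMap.coe_mk, AddHom.coe_mk, Prod.snd_add, Pi.add_apply]
      generalize (∑ i, (x i).val • u i).2 b = t at h1 ⊢
      simp only [gray3_apply, LinearMap.coe_mk, AddHom.coe_mk, Prod.snd_add, Prod.snd_sum,
        Prod.smul_snd, Pi.add_apply, Finset.sum_apply, Pi.smul_apply, smul_eq_mul, mul_add,
        Finset.sum_add_distrib]
      rw [h1, Finset.sum_mul]
      simp only [mul_assoc]
      ring
  rw [h]
  refine Submodule.add_mem_sup ⟨_, rfl⟩ ?_
  exact Submodule.sum_mem _ fun i _ => Submodule.smul_mem _ _ (Submodule.subset_span ⟨i, rfl⟩)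

theorem necessity (γ δ κ kbar rbar : ℕ) (h2 : 0 < γ + δ) (h3 : γ + δ ≤ β + κ) (h4 : κ ≤ min α γ)
    (𝒞 : AddSubgroup (Amb α β)) (e : 𝒞 ≃+ (Fin γ → ZMod 3) × (Fin δ → ZMod 9))
    (hκ : kappa3 α β 𝒞 = κ)
    (hk : Nat.card (kernelSet (Gray3 α β '' (𝒞 : Set (Amb α β)))) = 3 ^ (γ + 2 * δ - kbar))
    (hr : Module.finrank (ZMod 3)
      (Submodule.span (ZMod 3) (Gray3 α β '' (𝒞 : Set (Amb α β)))) = γ + 2 * δ + rbar) :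
    ((1 ≤ kbar ∧ kbar ≤ δ ∧ 1 ≤ rbar ∧
          rbar ≤ min (β - (γ - κ) - δ) (Nat.choose kbar 2 + Nat.choose (kbar + 2) 3)) ∨
        (kbar = 0 ∧ rbar = 0)) := by
  have : Fact (Nat.Prime 3) := ⟨Nat.prime_three⟩
  have p3 : Function.Injective (fun n : ℕ => 3 ^ n) := Nat.pow_right_injective (by norm_num)
  set S := Submodule.span (ZMod 3) (Gray3 α β '' (𝒞 : Set (Amb α β))) with hS
  have cC := card_code 𝒞 e
  have c3 := card_sub3 𝒞 e
  have cK : Nat.card (kerSub 𝒞) = 3 ^ (γ + 2 * δ - kbar) := by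
    rw [← hk, card_kernel]; rfl
  -- kbar ≤ δ
  have hkδ : kbar ≤ δ := by
    have h1 : Nat.card (sub3 𝒞) ≤ Nat.card (kerSub 𝒞) :=
      Nat.card_mono (Set.toFinite _) (sub3_le_kerSub 𝒞)
    rw [c3, cK] at h1
    have := (Nat.pow_le_pow_iff_right (by norm_num : 1 < 3)).1 h1
    omega
  have cW : Nat.card (kerW 𝒞) = 3 ^ (γ + 2 * δ - kbar) := by
    rw [← hk, kernel_eq]; rfl
  have fW : Module.finrank (ZMod 3) (kerW 𝒞) = γ + 2 * δ - kbar := by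
    have := Module.natCard_eq_pow_finrank (K := ZMod 3) (V := kerW 𝒞)
    rw [cW, Nat.card_zmod] at this
    exact (p3 this).symm
  have cS : Nat.card S = 3 ^ (γ + 2 * δ + rbar) := by
    have := Module.natCard_eq_pow_finrank (K := ZMod 3) (V := S)
    rwa [hr, Nat.card_zmod] at this
  have cGC : (Gray3 α β '' (𝒞 : Set (Amb α β))).ncard = 3 ^ (γ + 2 * δ) := by
    rw [Set.ncard_image_of_injective _ Gray3_injective, ← cC]; rfl
  have hWC : (kerW 𝒞 : Set (GV α β)) ⊆ Gray3 α β '' (𝒞 : Set (Amb α β)) := by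
    rintro _ ⟨u, hu, rfl⟩
    exact ⟨u, hu.1, rfl⟩
  -- first bound
  have hrs : rbar ≤ β - (γ - κ) - δ := by
    obtain ⟨u, -, hu⟩ := exists_gens 𝒞 (sub3 𝒞) (fun x hx => hx.1) (fun g hg => three_mem_sub3 hg) δ
      (by rw [cC, c3, ← pow_add]; congr 1; ring)
    set U := Submodule.span (ZMod 3)
      (Prod.fst '' {u : (Fin α → ZMod 3) × (Fin β → ZMod 9) | u ∈ 𝒞 ∧ 3 • u = 0}) with hU
    have hUf : Module.finrank (ZMod 3) U = κ := hκ
    have hle : S ≤ LinearMap.range (blockMap α β U) ⊔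
        Submodule.span (ZMod 3) (Set.range fun i => Gray3 α β (u i)) := by
      rw [hS, Submodule.span_le]
      rintro _ ⟨c, hc, rfl⟩
      obtain ⟨x, hx⟩ := hu c hc
      rw [← add_sub_cancel (∑ i, (x i).val • u i) c, Gray3_add_three _ hx.2]
      refine Submodule.add_mem _ (Gray3_comb_mem U u x) (Submodule.mem_sup_left ?_)
      set o := c - ∑ i, (x i).val • u i
      refine ⟨(⟨o.1, Submodule.subset_span ⟨o, hx, rfl⟩⟩, fun b => d2 (o.2 b)), ?_⟩
      refine Prod.ext rfl (funext fun b => funext fun i => ?_)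
      have h0 := (three_amb_iff o).1 hx.2 b
      simp [blockMap, Gray3, gray3_apply, h0]
    have h1 := Submodule.finrank_mono hle
    have h2 := Submodule.finrank_add_le_finrank_add_finrank (LinearMap.range (blockMap α β U))
      (Submodule.span (ZMod 3) (Set.range fun i => Gray3 α β (u i)))
    have h3' := LinearMap.finrank_range_le (blockMap α β U)
    have h4' := finrank_range_le_card (R := ZMod 3) (fun i => Gray3 α β (u i))
    rw [Module.finrank_prod, hUf, Module.finrank_fintype_fun_eq_card, Fintype.card_fin] at h3'
    rw [Fintype.card_fin, Set.finrank] at h4'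
    have h5 := h1.trans (h2.trans (add_le_add h3' h4'))
    rw [hr] at h5
    have := h4.trans (min_le_right _ _)
    omega
  -- second bound
  have hrM : rbar ≤ Nat.choose kbar 2 + Nat.choose (kbar + 2) 3 := by
    obtain ⟨u, -, hu⟩ := exists_gens 𝒞 (kerSub 𝒞) (fun x hx => hx.1)
      (fun g hg => sub3_le_kerSub _ (three_mem_sub3 hg)) kbar
      (by rw [cC, cK, ← pow_add]; congr 1; omega)
    have hle : S ≤ kerW 𝒞 ⊔ Submodule.span (ZMod 3)
      (Set.range fun x : Fin kbar → ZMod 3 => Gray3 α β (∑ i, (x i).val • u i)) := by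
      rw [hS, Submodule.span_le]
      rintro _ ⟨c, hc, rfl⟩
      obtain ⟨x, hx⟩ := hu c hc
      set o := c - ∑ i, (x i).val • u i with ho
      have hs : ∑ i, (x i).val • u i ∈ 𝒞 := by
        have : ∑ i, (x i).val • u i = c - o := by rw [ho]; abel
        rw [this]; exact 𝒞.sub_mem hc hx.1
      have hco : c = o + ∑ i, (x i).val • u i := by rw [ho]; abel
      rw [hco, Gray3_add]
      refine Submodule.add_mem _ (Submodule.add_mem_sup ⟨o, hx, rfl⟩ (Submodule.subset_span ⟨x, rfl⟩))
        (Submodule.mem_sup_left ⟨_, sub3_le_kerSub _ ⟨hx.2 _ hs, three_car _ _⟩, rfl⟩)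
    have h1 := Submodule.finrank_mono hle
    have h2 := Submodule.finrank_add_le_finrank_add_finrank (kerW 𝒞) (Submodule.span (ZMod 3)
      (Set.range fun x : Fin kbar → ZMod 3 => Gray3 α β (∑ i, (x i).val • u i)))
    have h3' := span_comb_le u
    have h5 := h1.trans (h2.trans (add_le_add fW.le h3'))
    rw [hr] at h5
    omega
  by_cases hk0 : kbar = 0
  · right
    refine ⟨hk0, ?_⟩
    subst hk0
    simpa using hrM
  · left
    refine ⟨by omega, hkδ, ?_, le_min hrs hrM⟩
    by_contra hr0
    have hr0 : rbar = 0 := by omega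
    subst hr0
    have hCS : Gray3 α β '' (𝒞 : Set (Amb α β)) = S := by
      refine Set.eq_of_subset_of_ncard_le Submodule.subset_span ?_ (Set.toFinite _)
      rw [cGC]
      exact cS.le
    have hall : ∀ u ∈ 𝒞, ∀ w ∈ 𝒞, car u w ∈ 𝒞 := by
      intro u hu w hw
      have h : Gray3 α β u + Gray3 α β w ∈ Gray3 α β '' (𝒞 : Set (Amb α β)) := by
        rw [hCS]
        exact S.add_mem (Submodule.subset_span ⟨u, hu, rfl⟩) (Submodule.subset_span ⟨w, hw, rfl⟩)
      rw [Gray3_add'] at h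
      obtain ⟨v, hv, hh⟩ := h
      have := Gray3_injective hh
      have h2 : car u w = u + w - v := by rw [this]; abel
      rw [h2]
      exact 𝒞.sub_mem (𝒞.add_mem hu hw) hv
    have : kerSub 𝒞 = 𝒞 := le_antisymm (fun x hx => hx.1) fun x hx => ⟨hx, hall x hx⟩
    rw [this, cC] at cK
    have := p3 cK
    omega

end necessity2

/-! ## Choice of the columns -/

section columns

variable {k : ℕ}

/-- The carry function of a column. -/
def fcol (a : Fin k → ZMod 3) : Fn k := fun x => d2 (∑ i, lf (a i) * lf (x i))

/-- Coordinates and carry functions. -/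
def vfam (k : ℕ) : Fin k ⊕ (Fin k → ZMod 3) → Fn k := Sum.elim co fcol

/-- The span of coordinates and carry functions. -/
def Qsp (k : ℕ) : Submodule (ZMod 3) (Fn k) := Submodule.span (ZMod 3) (Set.range (vfam k))

lemma co_memQ (i : Fin k) : co i ∈ Qsp k := Submodule.subset_span ⟨Sum.inl i, rfl⟩
lemma fcol_memQ (a : Fin k → ZMod 3) : fcol a ∈ Qsp k := Submodule.subset_span ⟨Sum.inr a, rfl⟩

lemma fcol_one (i : Fin k) (a : ZMod 3) (x : Fin k → ZMod 3) :
    fcol (fun l => if l = i then a else 0) x = d2 (lf a * lf (x i)) := by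
  simp only [fcol]
  rw [Finset.sum_eq_single i]
  · simp
  · intro b _ hb; simp [hb, lf_zero]
  · simp

lemma fcol_two {i j : Fin k} (hij : i ≠ j) (a b : ZMod 3) (x : Fin k → ZMod 3) :
    fcol (fun l => if l = i then a else if l = j then b else 0) x =
      d2 (lf a * lf (x i) + lf b * lf (x j)) := by
  simp only [fcol]
  rw [Finset.sum_eq_add i j hij]
  · simp [hij.symm]
  · rintro c _ ⟨hc, hc'⟩; simp [hc, hc', lf_zero]
  · simp
  · simp

lemma fcol_three {i j m : Fin k} (hij : i ≠ j) (him : i ≠ m) (hjm : j ≠ m) (x : Fin k → ZMod 3) :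
    fcol (fun l => if l = i then 1 else if l = j then 1 else if l = m then 1 else 0) x =
      d2 (lf (x i) + lf (x j) + lf (x m)) := by
  have h1 : lf 1 = 1 := by decide
  simp only [fcol]
  rw [← Finset.sum_subset (Finset.subset_univ {i, j, m})]
  · rw [Finset.sum_insert (by simp [hij, him]), Finset.sum_pair hjm]
    simp [hij.symm, him.symm, hjm.symm, h1, add_assoc]
  · intro c _ hc
    simp only [Finset.mem_insert, Finset.mem_singleton, not_or] at hc
    simp [hc, lf_zero]

lemma sq_memQ (i : Fin k) : co i * co i ∈ Qsp k := by
  have key : ∀ x : ZMod 3, x * x = 2 * d2 (lf 2 * lf x) + x := by decide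
  have : co i * co i = (2 : ZMod 3) • fcol (fun l => if l = i then 2 else 0) + co i := by
    funext x
    simp only [Pi.mul_apply, Pi.add_apply, Pi.smul_apply, fcol_one, co, smul_eq_mul]
    exact key _
  rw [this]
  exact Submodule.add_mem _ (Submodule.smul_mem _ _ (fcol_memQ _)) (co_memQ i)

lemma mul_memQ (i j : Fin k) : co i * co j ∈ Qsp k := by
  by_cases hij : i = j
  · subst hij; exact sq_memQ i
  have key : ∀ x y : ZMod 3, x * y = d2 (lf 1 * lf x + lf 1 * lf y) + d2 (lf 2 * lf x + lf 2 * lf y)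
      - d2 (lf 2 * lf x) - d2 (lf 2 * lf y) := by decide
  have : co i * co j = fcol (fun l => if l = i then 1 else if l = j then 1 else 0)
      + fcol (fun l => if l = i then 2 else if l = j then 2 else 0)
      - fcol (fun l => if l = i then 2 else 0) - fcol (fun l => if l = j then 2 else 0) := by
    funext x
    simp only [Pi.mul_apply, Pi.add_apply, Pi.sub_apply, fcol_one, fcol_two hij, co]
    exact key _ _
  rw [this]
  exact Submodule.sub_mem _ (Submodule.sub_mem _ (Submodule.add_mem _ (fcol_memQ _) (fcol_memQ _))
    (fcol_memQ _)) (fcol_memQ _)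

lemma sq_mul_memQ (i j : Fin k) : co i * co i * co j ∈ Qsp k := by
  by_cases hij : i = j
  · subst hij
    have h : co i * co i * co i = co i := by
      funext x
      exact cube_zmod3 _
    rw [h]; exact co_memQ i
  have key : ∀ x y : ZMod 3, x * x * y =
      d2 (lf 1 * lf x + lf 1 * lf y) + d2 (lf 2 * lf x + lf 1 * lf y) - d2 (lf 2 * lf x) := by
    decide
  have : co i * co i * co j = fcol (fun l => if l = i then 1 else if l = j then 1 else 0)
      + fcol (fun l => if l = i then 2 else if l = j then 1 else 0)
      - fcol (fun l => if l = i then 2 else 0) := by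
    funext x
    simp only [Pi.mul_apply, Pi.add_apply, Pi.sub_apply, fcol_one, fcol_two hij, co]
    exact key _ _
  rw [this]
  exact Submodule.sub_mem _ (Submodule.add_mem _ (fcol_memQ _) (fcol_memQ _)) (fcol_memQ _)

lemma mul_mul_memQ (i j m : Fin k) : co i * co j * co m ∈ Qsp k := by
  by_cases hij : i = j
  · subst hij; exact sq_mul_memQ i m
  by_cases him : i = m
  · subst him
    rw [mul_right_comm]; exact sq_mul_memQ i j
  by_cases hjm : j = m
  · subst hjm
    rw [mul_assoc, mul_comm]; exact sq_mul_memQ j i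
  have key : ∀ x y z : ZMod 3, x * y * z = d2 (lf x + lf y + lf z)
      - d2 (lf 1 * lf x + lf 1 * lf y) + x * z + y * z + x * x * z + y * y * z + z * z * x
      + z * z * y := by
    decide
  have : co i * co j * co m =
      fcol (fun l => if l = i then 1 else if l = j then 1 else if l = m then 1 else 0)
      - fcol (fun l => if l = i then 1 else if l = j then 1 else 0)
      + co i * co m + co j * co m + co i * co i * co m + co j * co j * co m + co m * co m * co i
      + co m * co m * co j := by
    funext x
    simp only [Pi.mul_apply, Pi.add_apply, Pi.sub_apply, fcol_three hij him hjm, fcol_two hij, co]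
    exact key _ _ _
  rw [this]
  refine Submodule.add_mem _ (Submodule.add_mem _ (Submodule.add_mem _ (Submodule.add_mem _
    (Submodule.add_mem _ (Submodule.add_mem _ (Submodule.sub_mem _ (fcol_memQ _) (fcol_memQ _))
    ?_) ?_) ?_) ?_) ?_) ?_
  · exact mul_memQ _ _
  · exact mul_memQ _ _
  all_goals exact sq_mul_memQ _ _

lemma Q_eq : Qsp k = PolyThree k := by
  apply le_antisymm
  · refine Submodule.span_le.2 ?_
    rintro _ ⟨i | a, rfl⟩
    · exact co_mem i
    · have := d2_comb_mem (fun i => lf (a i)) Finset.univ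
      simp only [mul_comm] at this
      exact this
  · refine Submodule.span_le.2 ?_
    rintro _ ⟨m | m, rfl⟩
    · obtain ⟨i, j, h⟩ := Multiset.card_eq_two.1 m.2
      have : mono k (Sum.inl m) = co i * co j := by
        funext x
        have h : (m : Multiset (Fin k)) = {i, j} := h
        simp [mono, co, h]
      rw [this]; exact mul_memQ i j
    · obtain ⟨i, j, l, h⟩ := Multiset.card_eq_three.1 m.2
      have : mono k (Sum.inr m) = co i * co j * co l := by
        funext x
        have h : (m : Multiset (Fin k)) = {i, j, l} := h
        simp [mono, co, h, mul_assoc]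
      rw [this]; exact mul_mul_memQ i j l

end columns

section columns2

variable {k : ℕ}

lemma co_indep : LinearIndependent (ZMod 3) (co (k := k)) := by
  rw [Fintype.linearIndependent_iff]
  intro c hc j
  have := congrFun hc (Pi.single j 1)
  simpa [Finset.sum_apply, co, Pi.single_apply] using this

lemma finrank_span_on {b : Set (Fin k ⊕ (Fin k → ZMod 3))}
    (hb : LinearIndepOn (ZMod 3) (vfam k) b) :
    Module.finrank (ZMod 3) (Submodule.span (ZMod 3) (vfam k '' b)) = b.ncard := by
  classical
  have : Fact (Nat.Prime 3) := ⟨Nat.prime_three⟩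
  have h := finrank_span_eq_card (R := ZMod 3) hb.linearIndependent
  rw [Set.image_eq_range, h, ← Nat.card_eq_fintype_card]
  rfl

lemma all_two_not_mem (hk : 1 ≤ k) :
    vfam k (Sum.inr fun _ => 2) ∉ Submodule.span (ZMod 3) (vfam k '' Set.range Sum.inl) := by
  intro h
  let i0 : Fin k := ⟨0, hk⟩
  let ev : Fn k →ₗ[ZMod 3] ZMod 3 :=
    { toFun := fun f => f (Pi.single i0 2) - 2 * f (Pi.single i0 1)
      map_add' := fun f g => by simp only [Pi.add_apply]; ring
      map_smul' := fun c f => by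
        simp only [Pi.smul_apply, smul_eq_mul, RingHom.id_apply]; ring }
  have hle : Submodule.span (ZMod 3) (vfam k '' Set.range Sum.inl) ≤ LinearMap.ker ev := by
    rw [Submodule.span_le]
    rintro _ ⟨_, ⟨i, rfl⟩, rfl⟩
    change ev (co i) = 0
    change (Pi.single i0 2 : Fin k → ZMod 3) i - 2 * (Pi.single i0 1 : Fin k → ZMod 3) i = 0
    by_cases hi : i = i0
    · subst hi; simp
    · simp [hi]
  have h1 : ev (fcol fun _ => 2) = 0 := hle h
  have hf : ∀ c : ZMod 3, fcol (k := k) (fun _ => 2) (Pi.single i0 c) = d2 (lf 2 * lf c) := by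
    intro c
    simp only [fcol]
    rw [Finset.sum_eq_single i0]
    · simp
    · intro b _ hb; simp [hb, lf_zero]
    · simp
  change fcol (k := k) (fun _ => 2) (Pi.single i0 2) -
    2 * fcol (k := k) (fun _ => 2) (Pi.single i0 1) = 0 at h1
  rw [hf, hf] at h1
  revert h1
  decide

theorem exists_cols (k r s : ℕ)
    (h : (1 ≤ k ∧ 1 ≤ r ∧ r ≤ s ∧ r ≤ Nat.choose k 2 + Nat.choose (k + 2) 3) ∨ (k = 0 ∧ r = 0)) :
    ∃ A : Fin s → Fin k → ZMod 3, (k = 0 ∨ ∃ l, ∀ i, A l i = 2) ∧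
      Module.finrank (ZMod 3) (Submodule.span (ZMod 3)
        (Set.range (co (k := k)) ∪ Set.range fun l => fcol (A l))) = k + r := by
  classical
  have : Fact (Nat.Prime 3) := ⟨Nat.prime_three⟩
  rcases h with ⟨hk, hr, hrs, hrM⟩ | ⟨rfl, rfl⟩
  · have hi : LinearIndepOn (ZMod 3) (vfam k) (Set.range Sum.inl) := by
      rw [linearIndepOn_range_iff Sum.inl_injective]
      exact co_indep
    have hi0 : LinearIndepOn (ZMod 3) (vfam k) (insert (Sum.inr fun _ => 2) (Set.range Sum.inl)) :=
      hi.insert (all_two_not_mem hk)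
    obtain ⟨b, -, hsb, hspan, hb⟩ := exists_linearIndepOn_extension hi0 (Set.subset_univ _)
    have hbQ : Submodule.span (ZMod 3) (vfam k '' b) = PolyThree k := by
      rw [← Q_eq, Qsp]
      apply le_antisymm
      · exact Submodule.span_mono (Set.image_subset_range _ _)
      · rw [Submodule.span_le, ← Set.image_univ]
        exact hspan
    have hbc : b.ncard = k + (Nat.choose k 2 + Nat.choose (k + 2) 3) := by
      rw [← finrank_span_on hb, hbQ, finrank_poly]
    have hrange : (Set.range (Sum.inl : Fin k → Fin k ⊕ (Fin k → ZMod 3))).ncard = k := by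
      rw [← Set.image_univ, Set.ncard_image_of_injective _ Sum.inl_injective, Set.ncard_univ]
      simp
    have hs0 : (insert (Sum.inr fun _ => 2)
        (Set.range (Sum.inl : Fin k → Fin k ⊕ (Fin k → ZMod 3)))).ncard = k + 1 := by
      rw [Set.ncard_insert_of_notMem (by simp) (Set.toFinite _), hrange]
    obtain ⟨b', hsb', hbb', hb'c⟩ := Set.exists_subsuperset_card_eq (n := k + r) hsb
      (by rw [hs0]; omega) (by rw [hbc]; omega)
    have hb' : LinearIndepOn (ZMod 3) (vfam k) b' := hb.mono hbb'
    let t : Set (Fin k → ZMod 3) := Sum.inr ⁻¹' b'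
    have hbt : b' = Set.range Sum.inl ∪ Sum.inr '' t := by
      ext x
      rcases x with i | a
      · simp [hsb' (Set.mem_insert_of_mem _ ⟨i, rfl⟩)]
      · simp [t]
    have htc : t.ncard = r := by
      have h1 : b'.ncard = k + t.ncard := by
        rw [hbt, Set.ncard_union_eq _ (Set.toFinite _) (Set.toFinite _), hrange,
          Set.ncard_image_of_injective _ Sum.inr_injective]
        rw [Set.disjoint_left]
        rintro _ ⟨i, rfl⟩ ⟨a, _, ha⟩
        cases ha
      omega
    have h2t : (fun _ => 2) ∈ t := hsb' (Set.mem_insert _ _)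
    have hsurj : ∃ g : Fin s → t, Function.Surjective g := by
      have : Nonempty t := ⟨⟨_, h2t⟩⟩
      have hc : Fintype.card t ≤ Fintype.card (Fin s) := by
        rw [Fintype.card_fin, ← Nat.card_eq_fintype_card]
        exact htc.le.trans hrs
      obtain ⟨e⟩ := Function.Embedding.nonempty_of_card_le hc
      exact ⟨Function.invFun e, Function.invFun_surjective e.injective⟩
    obtain ⟨g, hg⟩ := hsurj
    refine ⟨fun l => (g l).1, Or.inr ?_, ?_⟩
    · obtain ⟨l, hl⟩ := hg ⟨_, h2t⟩
      exact ⟨l, fun i => by simp only [hl]⟩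
    · rw [← hb'c, ← finrank_span_on hb']
      have hset : Set.range (co (k := k)) ∪ Set.range (fun l => fcol (g l).1) = vfam k '' b' := by
        rw [hbt, Set.image_union, ← Set.range_comp, ← Set.image_comp]
        congr 1
        ext f
        constructor
        · rintro ⟨l, rfl⟩
          exact ⟨(g l).1, (g l).2, rfl⟩
        · rintro ⟨a, ha, rfl⟩
          obtain ⟨l, hl⟩ := hg ⟨a, ha⟩
          exact ⟨l, by simp only [hl]; rfl⟩
      rw [hset]
  · refine ⟨fun _ _ => 0, Or.inl rfl, ?_⟩
    have : Submodule.span (ZMod 3) (Set.range (co (k := 0)) ∪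
        Set.range fun _ : Fin s => fcol (k := 0) fun _ => 0) = ⊥ := by
      rw [Submodule.span_eq_bot]
      rintro _ (⟨i, rfl⟩ | ⟨l, rfl⟩)
      · exact i.elim0
      · funext x
        simp [fcol, d2_zero]
    rw [this]
    simp

end columns2

/-! ## The construction -/

section construction

variable {α β κ α' g k d s : ℕ}

/-- Parameter group of the constructed code. -/
abbrev Par (κ g k d : ℕ) :=
  (Fin κ → ZMod 3) × (Fin g → ZMod 3) × (Fin k → ZMod 9) × (Fin d → ZMod 9)

/-- Quaternary-like coordinates of a codeword. -/
def cw (A : Fin s → Fin k → ZMod 3) (x : Par κ g k d) :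
    Fin g ⊕ (Fin k ⊕ (Fin d ⊕ Fin s)) → ZMod 9
  | Sum.inl j => 3 * lf (x.2.1 j)
  | Sum.inr (Sum.inl i) => x.2.2.1 i
  | Sum.inr (Sum.inr (Sum.inl i)) => x.2.2.2 i
  | Sum.inr (Sum.inr (Sum.inr l)) => ∑ i, lf (A l i) * x.2.2.1 i

lemma cw_add (A : Fin s → Fin k → ZMod 3) (x y : Par κ g k d) (b) :
    cw A (x + y) b = cw A x b + cw A y b := by
  rcases b with j | i | i | l
  · simp [cw, lf_add3]
  · simp [cw]
  · simp [cw]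
  · simp [cw, mul_add, Finset.sum_add_distrib]

/-- The encoding map. -/
def enc (A : Fin s → Fin k → ZMod 3) (eα : Fin α ≃ Fin κ ⊕ Fin α')
    (eβ : Fin β ≃ Fin g ⊕ (Fin k ⊕ (Fin d ⊕ Fin s))) : Par κ g k d →+ Amb α β :=
  AddMonoidHom.mk' (fun x => (fun a => Sum.elim x.1 0 (eα a), fun b => cw A x (eβ b))) (by
    intro x y
    refine Prod.ext (funext fun a => ?_) (funext fun b => cw_add A x y _)
    change Sum.elim (x + y).1 0 (eα a) = Sum.elim x.1 0 (eα a) + Sum.elim y.1 0 (eα a)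
    rcases eα a with j | j <;> simp)

variable (A : Fin s → Fin k → ZMod 3) (eα : Fin α ≃ Fin κ ⊕ Fin α')
    (eβ : Fin β ≃ Fin g ⊕ (Fin k ⊕ (Fin d ⊕ Fin s)))

lemma enc_fst (x : Par κ g k d) (j : Fin κ) : (enc A eα eβ x).1 (eα.symm (Sum.inl j)) = x.1 j := by
  change Sum.elim x.1 0 (eα (eα.symm (Sum.inl j))) = _
  simp

lemma enc_snd (x : Par κ g k d) (b) : (enc A eα eβ x).2 (eβ.symm b) = cw A x b := by
  change cw A x (eβ (eβ.symm b)) = _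
  simp

lemma lf3_inj : ∀ a b : ZMod 3, 3 * lf a = 3 * lf b → a = b := by decide

lemma enc_injective : Function.Injective (enc A eα eβ) := by
  intro x y h
  have h1 : ∀ j, x.1 j = y.1 j := fun j => by rw [← enc_fst A eα eβ, h, enc_fst]
  have h2 : ∀ b, cw A x b = cw A y b := fun b => by rw [← enc_snd A eα eβ, h, enc_snd]
  refine Prod.ext (funext h1) (Prod.ext (funext fun j => ?_) (Prod.ext (funext fun i => ?_)
    (funext fun i => ?_)))
  · exact lf3_inj _ _ (h2 (Sum.inl j))
  · exact h2 (Sum.inr (Sum.inl i))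
  · exact h2 (Sum.inr (Sum.inr (Sum.inl i)))

/-- Reindexing the parameter group. -/
def parEquiv {γ δ : ℕ} (eγ : Fin γ ≃ Fin κ ⊕ Fin g) (eδ : Fin δ ≃ Fin k ⊕ Fin d) :
    Par κ g k d ≃+ (Fin γ → ZMod 3) × (Fin δ → ZMod 9) where
  toFun x := (fun c => Sum.elim x.1 x.2.1 (eγ c), fun i => Sum.elim x.2.2.1 x.2.2.2 (eδ i))
  invFun y := (fun j => y.1 (eγ.symm (Sum.inl j)), fun j => y.1 (eγ.symm (Sum.inr j)),
    fun i => y.2 (eδ.symm (Sum.inl i)), fun i => y.2 (eδ.symm (Sum.inr i)))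
  left_inv x := by simp
  right_inv y := by
    refine Prod.ext (funext fun c => ?_) (funext fun i => ?_)
    · obtain ⟨c, rfl⟩ := eγ.symm.surjective c
      rcases c with c | c <;> simp
    · obtain ⟨c, rfl⟩ := eδ.symm.surjective i
      rcases c with c | c <;> simp
  map_add' x y := by
    refine Prod.ext (funext fun c => ?_) (funext fun i => ?_)
    · obtain ⟨c, rfl⟩ := eγ.symm.surjective c
      rcases c with c | c <;> simp
    · obtain ⟨c, rfl⟩ := eδ.symm.surjective i
      rcases c with c | c <;> simp

lemma enc_kappa : kappa3 α β (enc A eα eβ).range = κ := by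
  have : Fact (Nat.Prime 3) := ⟨Nat.prime_three⟩
  let ι : (Fin κ → ZMod 3) →ₗ[ZMod 3] (Fin α → ZMod 3) :=
    { toFun := fun z a => Sum.elim z 0 (eα a)
      map_add' := fun x y => by
        funext a
        simp only [Pi.add_apply]
        rcases eα a with j | j <;> simp
      map_smul' := fun c x => by
        funext a
        simp only [Pi.smul_apply, RingHom.id_apply]
        rcases eα a with j | j <;> simp }
  have hset : Prod.fst '' {u : (Fin α → ZMod 3) × (Fin β → ZMod 9) |
      u ∈ (enc A eα eβ).range ∧ 3 • u = 0} = (LinearMap.range ι : Set (Fin α → ZMod 3)) := by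
    ext z
    constructor
    · rintro ⟨_, ⟨⟨x, rfl⟩, _⟩, rfl⟩
      exact ⟨x.1, rfl⟩
    · rintro ⟨x, rfl⟩
      refine ⟨enc A eα eβ (x, 0, 0, 0), ⟨⟨_, rfl⟩, ?_⟩, rfl⟩
      rw [three_amb_iff]
      intro j
      change d1 (cw A (x, 0, 0, 0) (eβ j)) = 0
      rcases eβ j with b | b | b | b <;> simp [cw, lf_zero, d1_zero]
  rw [kappa3, hset, Submodule.span_eq, LinearMap.finrank_range_of_inj]
  · simp
  · intro x y h
    funext j
    have := congrFun h (eα.symm (Sum.inl j))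
    simpa [ι] using this

lemma two_test : ∀ a σ : ZMod 3,
    lf 2 * (3 * lf (cy a (d1 1))) = 3 * lf (cy σ (d1 (lf 2 * 1))) →
    lf 2 * (3 * lf (cy a (d1 2))) = 3 * lf (cy σ (d1 (lf 2 * 2))) → a = 0 := by decide

lemma enc_kerPart (hA : k = 0 ∨ ∃ l, ∀ i, A l i = 2) :
    kerPart (enc A eα eβ).range = enc A eα eβ '' {x | ∀ i, d1 (x.2.2.1 i) = 0} := by
  ext u
  constructor
  · rintro ⟨⟨x, rfl⟩, hc⟩
    refine ⟨x, fun i => ?_, rfl⟩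
    rcases hA with rfl | ⟨l, hl⟩
    · exact i.elim0
    have key : ∀ c : ZMod 9, lf 2 * (3 * lf (cy (d1 (x.2.2.1 i)) (d1 c))) =
        3 * lf (cy (d1 (∑ j, lf 2 * x.2.2.1 j)) (d1 (lf 2 * c))) := by
      intro c
      let x' : Par κ g k d := (0, 0, Pi.single i c, 0)
      obtain ⟨x'', hx''⟩ := hc (enc A eα eβ x') ⟨x', rfl⟩
      have hb : ∀ b, cw A x'' b = 3 * lf (cy (d1 (cw A x b)) (d1 (cw A x' b))) := by
        intro b
        rw [← enc_snd A eα eβ x'', hx'']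
        change 3 * lf (cy (d1 ((enc A eα eβ x).2 (eβ.symm b))) (d1 ((enc A eα eβ x').2 (eβ.symm b)))) = _
        rw [enc_snd, enc_snd]
      have h1 : ∀ j, x''.2.2.1 j = 3 * lf (cy (d1 (x.2.2.1 j)) (d1 ((Pi.single i c : Fin k → ZMod 9) j))) :=
        fun j => hb (Sum.inr (Sum.inl j))
      have h2 := hb (Sum.inr (Sum.inr (Sum.inr l)))
      simp only [cw, hl, h1] at h2
      rw [Finset.sum_eq_single i] at h2
      · rw [Pi.single_eq_same] at h2
        rw [h2]
        congr 4
        simp only [x']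
        rw [Finset.sum_eq_single i]
        · simp
        · intro j _ hj; simp [hj]
        · simp
      · intro j _ hj
        simp [hj, d1_zero, cy_zero_right, lf_zero]
      · simp
    exact two_test _ _ (key 1) (key 2)
  · rintro ⟨x, hx, rfl⟩
    have hx : ∀ i, d1 (x.2.2.1 i) = 0 := hx
    refine ⟨⟨x, rfl⟩, ?_⟩
    rintro _ ⟨y, rfl⟩
    refine ⟨(0, 0, 0, fun i => 3 * lf (cy (d1 (x.2.2.2 i)) (d1 (y.2.2.2 i)))), ?_⟩
    refine Prod.ext (funext fun a => ?_) (funext fun b => ?_)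
    · change Sum.elim (0 : Fin κ → ZMod 3) 0 (eα a) = 0
      rcases eα a with j | j <;> simp
    · change cw A _ (eβ b) = 3 * lf (cy (d1 (cw A x (eβ b))) (d1 (cw A y (eβ b))))
      rcases eβ b with j | i | i | l
      · simp [cw, d1_three_mul, cy_zero_left, lf_zero]
      · simp [cw, hx, cy_zero_left, lf_zero]
      · simp [cw]
      · simp [cw, d1_sum, d1_mul, hx, cy_zero_left, lf_zero]

lemma enc_card_ker (hA : k = 0 ∨ ∃ l, ∀ i, A l i = 2) :
    Nat.card (kernelSet (Gray3 α β '' ((enc A eα eβ).range : Set (Amb α β)))) =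
      3 ^ (κ + g + k + 2 * d) := by
  rw [card_kernel, enc_kerPart A eα eβ hA, Nat.card_image_of_injective (enc_injective A eα eβ)]
  have h9 : Nat.card {θ : ZMod 9 // d1 θ = 0} = 3 := by
    rw [Nat.card_eq_fintype_card]; decide
  let e3 : {x : Par κ g k d | ∀ i, d1 (x.2.2.1 i) = 0} ≃
      (Fin κ → ZMod 3) × (Fin g → ZMod 3) × (Fin k → {θ : ZMod 9 // d1 θ = 0}) × (Fin d → ZMod 9) :=
    { toFun := fun x => (x.1.1, x.1.2.1, fun i => ⟨x.1.2.2.1 i, x.2 i⟩, x.1.2.2.2)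
      invFun := fun y => ⟨(y.1, y.2.1, fun i => (y.2.2.1 i).1, y.2.2.2), fun i => (y.2.2.1 i).2⟩
      left_inv := fun _ => rfl
      right_inv := fun _ => rfl }
  rw [Nat.card_congr e3, Nat.card_prod, Nat.card_prod, Nat.card_prod, Nat.card_fun, Nat.card_fun,
    Nat.card_fun, Nat.card_fun, h9]
  simp [pow_add, pow_mul, mul_assoc]

end construction

/-! ## Rank of the constructed code -/

section rank

variable {α β κ α' g k d s : ℕ}

/-- The coordinate functions of a family of vectors. -/
def coordF {X : Type*} (F : X → GV α β) : Fin α ⊕ Fin β × Fin 3 → X → ZMod 3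
  | Sum.inl a => fun x => (F x).1 a
  | Sum.inr p => fun x => (F x).2 p.1 p.2

/-- Flattening of the ambient space. -/
def flat (α β : ℕ) : GV α β →ₗ[ZMod 3] (Fin α ⊕ Fin β × Fin 3 → ZMod 3) where
  toFun v := Sum.elim v.1 (fun p => v.2 p.1 p.2)
  map_add' v w := by funext c; rcases c with c | c <;> rfl
  map_smul' r v := by funext c; rcases c with c | c <;> rfl

lemma flat_injective : Function.Injective (flat α β) := by
  intro v w h
  refine Prod.ext (funext fun a => ?_) (funext fun b => funext fun i => ?_)
  · exact congrFun h (Sum.inl a)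
  · exact congrFun h (Sum.inr (b, i))

lemma rank_coord {X : Type*} [Fintype X] (F : X → GV α β) :
    Module.finrank (ZMod 3) (Submodule.span (ZMod 3) (Set.range F)) =
      Module.finrank (ZMod 3) (Submodule.span (ZMod 3) (Set.range (coordF F))) := by
  have : Fact (Nat.Prime 3) := ⟨Nat.prime_three⟩
  let M : Matrix X (Fin α ⊕ Fin β × Fin 3) (ZMod 3) := Matrix.of fun x => flat α β (F x)
  have h1 := M.rank_eq_finrank_span_row
  have h2 := M.rank_eq_finrank_span_cols
  have hr : Set.range M.row = flat α β '' Set.range F := by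
    rw [← Set.range_comp]; rfl
  have hc : M.col = coordF F := by
    funext c x
    rcases c with c | c <;> rfl
  rw [hr, Submodule.span_image, ← LinearEquiv.finrank_eq
    (Submodule.equivMapOfInjective (flat α β) flat_injective _)] at h1
  rw [hc] at h2
  rw [← h1, h2]

/-- The basic coordinate functions. -/
def hfun : Fin κ ⊕ (Fin g ⊕ (Fin k ⊕ (Fin d ⊕ Fin d))) → Par κ g k d → ZMod 3
  | Sum.inl j => fun x => x.1 j
  | Sum.inr (Sum.inl j) => fun x => x.2.1 j
  | Sum.inr (Sum.inr (Sum.inl i)) => fun x => d2 (x.2.2.1 i)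
  | Sum.inr (Sum.inr (Sum.inr (Sum.inl i))) => fun x => d2 (x.2.2.2 i)
  | Sum.inr (Sum.inr (Sum.inr (Sum.inr i))) => fun x => d1 (x.2.2.2 i)

/-- Pull back of functions along the first digit. -/
def pull (κ g k d : ℕ) : Fn k →ₗ[ZMod 3] (Par κ g k d → ZMod 3) :=
  LinearMap.funLeft (ZMod 3) (ZMod 3) (fun x i => d1 (x.2.2.1 i))

lemma pull_apply (f : Fn k) (x : Par κ g k d) : pull κ g k d f x = f fun i => d1 (x.2.2.1 i) := rfl

/-- Dual points. -/
def dpt : Fin κ ⊕ (Fin g ⊕ (Fin k ⊕ (Fin d ⊕ Fin d))) → Par κ g k d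
  | Sum.inl j => (Pi.single j 1, 0, 0, 0)
  | Sum.inr (Sum.inl j) => (0, Pi.single j 1, 0, 0)
  | Sum.inr (Sum.inr (Sum.inl i)) => (0, 0, Pi.single i 3, 0)
  | Sum.inr (Sum.inr (Sum.inr (Sum.inl i))) => (0, 0, 0, Pi.single i 3)
  | Sum.inr (Sum.inr (Sum.inr (Sum.inr i))) => (0, 0, 0, Pi.single i 1)

lemma d2_single {n : ℕ} (i j : Fin n) (c : ZMod 9) :
    d2 ((Pi.single i c : Fin n → ZMod 9) j) = if i = j then d2 c else 0 := by
  by_cases h : i = j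
  · subst h; simp
  · rw [Pi.single_eq_of_ne (Ne.symm h), if_neg h, d2_zero]

lemma d1_single {n : ℕ} (i j : Fin n) (c : ZMod 9) :
    d1 ((Pi.single i c : Fin n → ZMod 9) j) = if i = j then d1 c else 0 := by
  by_cases h : i = j
  · subst h; simp
  · rw [Pi.single_eq_of_ne (Ne.symm h), if_neg h, d1_zero]

lemma z_single {n : ℕ} (i j : Fin n) (c : ZMod 3) :
    (Pi.single i c : Fin n → ZMod 3) j = if i = j then c else 0 := by
  by_cases h : i = j
  · subst h; simp
  · rw [Pi.single_eq_of_ne (Ne.symm h), if_neg h]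

lemma hfun_dpt (i j : Fin κ ⊕ (Fin g ⊕ (Fin k ⊕ (Fin d ⊕ Fin d)))) :
    hfun j (dpt i) = if i = j then 1 else 0 := by
  have e1 : d2 3 = 1 := by decide
  have e2 : d1 3 = 0 := by decide
  have e3 : d2 1 = 0 := by decide
  have e4 : d1 1 = 1 := by decide
  rcases i with i | i | i | i | i <;> rcases j with j | j | j | j | j <;>
    simp [hfun, dpt, d2_single, d1_single, d1_zero, d2_zero, e1, e2, e3, e4, z_single]

/-- The parametrisation of the span of the coordinate functions. -/
noncomputable def Lam (U : Submodule (ZMod 3) (Fn k)) :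
    ((Fin κ ⊕ (Fin g ⊕ (Fin k ⊕ (Fin d ⊕ Fin d))) → ZMod 3) × U) →ₗ[ZMod 3]
      (Par κ g k d → ZMod 3) :=
  LinearMap.coprod (Fintype.linearCombination (ZMod 3) hfun) (pull κ g k d ∘ₗ U.subtype)

lemma Lam_apply (U : Submodule (ZMod 3) (Fn k)) (c) (x : Par κ g k d) :
    Lam U c x = ∑ j, c.1 j * hfun j x + (c.2 : Fn k) fun i => d1 (x.2.2.1 i) := by
  simp [Lam, Fintype.linearCombination_apply, pull_apply]

lemma Lam_injective (U : Submodule (ZMod 3) (Fn k)) :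
    Function.Injective (Lam (κ := κ) (g := g) (d := d) U) := by
  rw [← LinearMap.ker_eq_bot, LinearMap.ker_eq_bot']
  rintro ⟨c, f⟩ h
  have hf : (f : Fn k) = 0 := by
    funext t
    have := congrFun h ((0, 0, fun i => lf (t i), 0) : Par κ g k d)
    rw [Lam_apply, Finset.sum_eq_zero] at this
    · simpa [d1_lf] using this
    · rintro j -
      rcases j with j | j | j | j | j <;> simp [hfun, d2_lf, d1_zero, d2_zero]
  have hc : c = 0 := by
    funext j
    have := congrFun h (dpt j)
    rw [Lam_apply] at this
    simpa [hf, hfun_dpt] using this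
  rw [hc, Submodule.coe_eq_zero.mp hf]
  rfl

lemma Lam_range (U : Submodule (ZMod 3) (Fn k)) :
    LinearMap.range (Lam (κ := κ) (g := g) (d := d) U) =
      Submodule.span (ZMod 3) (Set.range hfun) ⊔ U.map (pull κ g k d) := by
  rw [Lam, LinearMap.range_coprod, Fintype.range_linearCombination, LinearMap.range_comp,
    Submodule.range_subtype]

lemma col_digits (a : Fin k → ZMod 3) (y : Fin k → ZMod 9) :
    d2 (∑ i, lf (a i) * y i) = ∑ i, a i * d2 (y i) + fcol a fun i => d1 (y i) := by
  have h : ∑ i, lf (a i) * y i =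
      3 * (∑ i, lf (a i) * lf (d2 (y i))) + ∑ i, lf (a i) * lf (d1 (y i)) := by
    rw [Finset.mul_sum, ← Finset.sum_add_distrib]
    refine Finset.sum_congr rfl fun i _ => ?_
    conv_lhs => rw [digit_decomp (y i)]
    ring
  rw [h, d2_add, d1_three_mul, d2_three_mul, cy_zero_left, d1_sum]
  simp [d1_mul, d1_lf, fcol]

variable (A : Fin s → Fin k → ZMod 3) (eα : Fin α ≃ Fin κ ⊕ Fin α')
    (eβ : Fin β ≃ Fin g ⊕ (Fin k ⊕ (Fin d ⊕ Fin s)))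

/-- The carry space of the construction. -/
def Usp : Submodule (ZMod 3) (Fn k) :=
  Submodule.span (ZMod 3) (Set.range (co (k := k)) ∪ Set.range fun l => fcol (A l))

lemma d1_cw_mem (b) : (fun x : Par κ g k d => d1 (cw A x b)) ∈
    Submodule.span (ZMod 3) (Set.range hfun) ⊔ (Usp A).map (pull κ g k d) := by
  rcases b with j | i | i | l
  · simp only [cw, d1_three_mul]
    exact zero_mem _
  · exact Submodule.mem_sup_right ⟨co i, Submodule.subset_span (Or.inl ⟨i, rfl⟩), rfl⟩
  · exact Submodule.mem_sup_left
      (Submodule.subset_span ⟨Sum.inr (Sum.inr (Sum.inr (Sum.inr i))), rfl⟩)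
  · refine Submodule.mem_sup_right ⟨∑ i, A l i • co i, ?_, ?_⟩
    · exact Submodule.sum_mem _ fun i _ => Submodule.smul_mem _ _
        (Submodule.subset_span (Or.inl ⟨i, rfl⟩))
    · funext x
      simp [pull_apply, cw, d1_sum, d1_mul, d1_lf, co]

lemma d2_cw_mem (b) : (fun x : Par κ g k d => d2 (cw A x b)) ∈
    Submodule.span (ZMod 3) (Set.range hfun) ⊔ (Usp A).map (pull κ g k d) := by
  rcases b with j | i | i | l
  · simp only [cw, d2_three_mul, d1_lf]
    exact Submodule.mem_sup_left (Submodule.subset_span ⟨Sum.inr (Sum.inl j), rfl⟩)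
  · exact Submodule.mem_sup_left (Submodule.subset_span ⟨Sum.inr (Sum.inr (Sum.inl i)), rfl⟩)
  · exact Submodule.mem_sup_left
      (Submodule.subset_span ⟨Sum.inr (Sum.inr (Sum.inr (Sum.inl i))), rfl⟩)
  · have : (fun x : Par κ g k d => d2 (cw A x (Sum.inr (Sum.inr (Sum.inr l))))) =
        ∑ i, A l i • hfun (Sum.inr (Sum.inr (Sum.inl i))) + pull κ g k d (fcol (A l)) := by
      funext x
      simp [cw, col_digits, hfun, pull_apply]
    rw [this]
    refine Submodule.add_mem _ (Submodule.sum_mem _ fun i _ => Submodule.smul_mem _ _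
      (Submodule.mem_sup_left (Submodule.subset_span ⟨_, rfl⟩))) (Submodule.mem_sup_right
      ⟨fcol (A l), Submodule.subset_span (Or.inr ⟨l, rfl⟩), rfl⟩)

lemma coord_span : Submodule.span (ZMod 3)
      (Set.range (coordF fun x : Par κ g k d => Gray3 α β (enc A eα eβ x))) =
    Submodule.span (ZMod 3) (Set.range hfun) ⊔ (Usp A).map (pull κ g k d) := by
  set S := Submodule.span (ZMod 3)
      (Set.range (coordF fun x : Par κ g k d => Gray3 α β (enc A eα eβ x))) with hS
  apply le_antisymm
  · rw [hS, Submodule.span_le]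
    rintro _ ⟨a | ⟨b, i⟩, rfl⟩
    · change (fun x : Par κ g k d => Sum.elim x.1 0 (eα a)) ∈ _
      rcases eα a with j | j
      · exact Submodule.mem_sup_left (Submodule.subset_span ⟨Sum.inl j, rfl⟩)
      · exact zero_mem _
    · have : coordF (fun x : Par κ g k d => Gray3 α β (enc A eα eβ x)) (Sum.inr (b, i)) =
          (fun x => d2 (cw A x (eβ b))) + ((i : ℕ) : ZMod 3) • fun x => d1 (cw A x (eβ b)) := by
        funext x
        change d2 (cw A x (eβ b)) + d1 (cw A x (eβ b)) * ((i : ℕ) : ZMod 3) = _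
        simp [mul_comm]
      rw [this]
      exact Submodule.add_mem _ (d2_cw_mem A _) (Submodule.smul_mem _ _ (d1_cw_mem A _))
  · have hz (j : Fin κ) : (fun x : Par κ g k d => x.1 j) ∈ S := by
      refine Submodule.subset_span ⟨Sum.inl (eα.symm (Sum.inl j)), ?_⟩
      funext x
      exact enc_fst A eα eβ x j
    have hg (b) (i : Fin 3) : (fun x : Par κ g k d =>
        d2 (cw A x b) + d1 (cw A x b) * ((i : ℕ) : ZMod 3)) ∈ S := by
      refine Submodule.subset_span ⟨Sum.inr (eβ.symm b, i), ?_⟩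
      funext x
      rw [← enc_snd A eα eβ x b]
      rfl
    have h2 (b) : (fun x : Par κ g k d => d2 (cw A x b)) ∈ S := by simpa using hg b 0
    have h1 (b) : (fun x : Par κ g k d => d1 (cw A x b)) ∈ S := by
      have := Submodule.sub_mem _ (hg b 1) (h2 b)
      convert this using 1
      funext x
      simp
    refine sup_le ?_ ?_
    · rw [Submodule.span_le]
      rintro _ ⟨j | j | j | j | j, rfl⟩
      · exact hz j
      · have := h2 (Sum.inl j)
        simp only [cw, d2_three_mul, d1_lf] at this
        exact this
      · exact h2 (Sum.inr (Sum.inl j))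
      · exact h2 (Sum.inr (Sum.inr (Sum.inl j)))
      · exact h1 (Sum.inr (Sum.inr (Sum.inl j)))
    · rw [Submodule.map_le_iff_le_comap, Usp, Submodule.span_le]
      rintro _ (⟨i, rfl⟩ | ⟨l, rfl⟩)
      · exact h1 (Sum.inr (Sum.inl i))
      · change pull κ g k d (fcol (A l)) ∈ S
        have : pull κ g k d (fcol (A l)) =
            (fun x : Par κ g k d => d2 (cw A x (Sum.inr (Sum.inr (Sum.inr l))))) -
            ∑ i, A l i • fun x : Par κ g k d => d2 (cw A x (Sum.inr (Sum.inl i))) := by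
          funext x
          simp [cw, col_digits, pull_apply]
        rw [this]
        exact Submodule.sub_mem _ (h2 _) (Submodule.sum_mem _ fun i _ =>
          Submodule.smul_mem _ _ (h2 _))

lemma enc_rank : Module.finrank (ZMod 3) (Submodule.span (ZMod 3)
      (Gray3 α β '' ((enc A eα eβ).range : Set (Amb α β)))) =
    κ + (g + (k + (d + d))) + Module.finrank (ZMod 3) (Usp A) := by
  have : Fact (Nat.Prime 3) := ⟨Nat.prime_three⟩
  have hs : Gray3 α β '' ((enc A eα eβ).range : Set (Amb α β)) =
      Set.range fun x => Gray3 α β (enc A eα eβ x) := by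
    rw [AddMonoidHom.coe_range, ← Set.range_comp]; rfl
  rw [hs, rank_coord, coord_span, ← Lam_range, LinearMap.finrank_range_of_inj (Lam_injective _)]
  simp

end rank

/-- There is a `Z₃Z₉`-additive code of type `(α, β; γ, δ; κ)` with kernel dimension
`γ + 2δ − k̄` and rank `γ + 2δ + r̄` iff `1 ≤ k̄ ≤ δ` and
`1 ≤ r̄ ≤ min(β − (γ − κ) − δ, C(k̄,2) + C(k̄+2,3))`, or `k̄ = r̄ = 0`. -/
theorem exists_code_with_rank_and_kernel_iff (α β γ δ κ kbar rbar : ℕ)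
    (h1 : α + β > 0) (h2 : 0 < γ + δ) (h3 : γ + δ ≤ β + κ) (h4 : κ ≤ min α γ) :
    (∃ 𝒞 : AddSubgroup ((Fin α → ZMod 3) × (Fin β → ZMod 9)),
        Nonempty (𝒞 ≃+ (Fin γ → ZMod 3) × (Fin δ → ZMod 9)) ∧
        kappa3 α β 𝒞 = κ ∧
        Nat.card
            (kernelSet (Gray3 α β '' (𝒞 : Set ((Fin α → ZMod 3) × (Fin β → ZMod 9))))) =
          3 ^ (γ + 2 * δ - kbar) ∧
        Module.finrank (ZMod 3)
            (Submodule.span (ZMod 3)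
              (Gray3 α β '' (𝒞 : Set ((Fin α → ZMod 3) × (Fin β → ZMod 9))))) =
          γ + 2 * δ + rbar) ↔
      ((1 ≤ kbar ∧ kbar ≤ δ ∧ 1 ≤ rbar ∧
          rbar ≤ min (β - (γ - κ) - δ) (Nat.choose kbar 2 + Nat.choose (kbar + 2) 3)) ∨
        (kbar = 0 ∧ rbar = 0)) := by
  constructor
  · rintro ⟨𝒞, ⟨e⟩, hκ, hk, hr⟩
    exact necessity γ δ κ kbar rbar h2 h3 h4 𝒞 e hκ hk hr
  · intro h
    have hκα : κ ≤ α := h4.trans (min_le_left _ _)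
    have hκγ : κ ≤ γ := h4.trans (min_le_right _ _)
    have hkδ : kbar ≤ δ := by rcases h with ⟨_, h, _⟩ | ⟨h, _⟩ <;> omega
    obtain ⟨A, hA, hU⟩ := exists_cols kbar rbar (β - (γ - κ) - δ) (by
      rcases h with ⟨a, _, b, c⟩ | ⟨a, b⟩
      · exact Or.inl ⟨a, b, c.trans (min_le_left _ _), c.trans (min_le_right _ _)⟩
      · exact Or.inr ⟨a, b⟩)
    let eα : Fin α ≃ Fin κ ⊕ Fin (α - κ) := Fintype.equivOfCardEq (by simp; omega)
    let eβ : Fin β ≃ Fin (γ - κ) ⊕ (Fin kbar ⊕ (Fin (δ - kbar) ⊕ Fin (β - (γ - κ) - δ))) :=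
      Fintype.equivOfCardEq (by simp; omega)
    let eγ : Fin γ ≃ Fin κ ⊕ Fin (γ - κ) := Fintype.equivOfCardEq (by simp; omega)
    let eδ : Fin δ ≃ Fin kbar ⊕ Fin (δ - kbar) := Fintype.equivOfCardEq (by simp; omega)
    refine ⟨(enc A eα eβ).range, ⟨?_⟩, enc_kappa A eα eβ, ?_, ?_⟩
    · exact (AddMonoidHom.ofInjective (enc_injective A eα eβ)).symm.trans (parEquiv eγ eδ)
    · rw [enc_card_ker A eα eβ hA]
      congr 1
      omega
    · rw [enc_rank A eα eβ, Usp, hU]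
      omega
end
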